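/- arXiv:0811.4144 — 3 statements merged into one kernel-verified Lean document; each statement's English description precedes it below -/
import Mathlib

section
/- There exists a linearly ordered set Z such that: (1) the cardinality of Z is at most ℵ₁; (2) every increasing ω₁-sequence in Z that is bounded above has a supremum in Z, and every decreasing ω₁-sequence in Z that is bounded below has an infimum in Z; (3') every uncountable subset of Z contains a subset order-isomorphic to ω₁ or a subset order-isomorphic to ω₁ with the reversed order; and yet the compact line 𝕂(Z) is not Valdivia. -/
universe u

open Set Filter Topology

/-- A compact space `K` is *Valdivia* if it embeds into some `ℝ^Γ` so that the points of the
image with countable support form a dense subset (of the image, equivalently the preimage of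
`Σ(Γ)` is dense in `K`). -/
def IsValdivia (K : Type u) [TopologicalSpace K] : Prop :=
  ∃ (Γ : Type u) (h : K → Γ → ℝ),
    Topology.IsEmbedding h ∧ Dense {x : K | {γ : Γ | h x γ ≠ 0}.Countable}

/-- `𝕂(X)`: the space of final segments of a linearly ordered set `X`, identified with their
characteristic functions, as a (closed) subspace of the Cantor cube `{0,1}^X`. -/
abbrev FinalSegs (X : Type u) [LinearOrder X] : Type u :=
  {F : X → Bool // ∀ x y : X, x ≤ y → F x = true → F y = true}

/-- The first uncountable ordinal. -/
noncomputable def omega1 : Ordinal.{0} := (Cardinal.aleph 1).ord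

/-- `C` is a closed unbounded subset of `ω₁`. -/
noncomputable def IsClubInOmega1 (C : Set Ordinal.{0}) : Prop :=
  C ⊆ Set.Iio omega1 ∧ (∀ a < omega1, ∃ b ∈ C, a < b) ∧
    ∀ a < omega1, (C ∩ Set.Iio a).Nonempty → sSup (C ∩ Set.Iio a) = a → a ∈ C

/-- `S` is a stationary subset of `ω₁`: it meets every closed unbounded subset of `ω₁`. -/
noncomputable def IsStationaryInOmega1 (S : Set Ordinal.{0}) : Prop :=
  S ⊆ Set.Iio omega1 ∧ ∀ C : Set Ordinal.{0}, IsClubInOmega1 C → (S ∩ C).Nonempty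

/-- Every increasing `ω₁`-sequence in `X` which is bounded above has a supremum in `X`. -/
noncomputable def HasOmega1Sups (X : Type u) [LinearOrder X] : Prop :=
  ∀ g : Ordinal.{0} → X,
    (∀ a b : Ordinal, a < omega1 → b < omega1 → a ≤ b → g a ≤ g b) →
    (∃ ub : X, ∀ a < omega1, g a ≤ ub) →
    ∃ s : X, IsLUB (g '' Set.Iio omega1) s

/-- Every decreasing `ω₁`-sequence in `X` which is bounded below has an infimum in `X`. -/
noncomputable def HasOmega1Infs (X : Type u) [LinearOrder X] : Prop :=
  ∀ g : Ordinal.{0} → X,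
    (∀ a b : Ordinal, a < omega1 → b < omega1 → a ≤ b → g b ≤ g a) →
    (∃ lb : X, ∀ a < omega1, lb ≤ g a) →
    ∃ s : X, IsGLB (g '' Set.Iio omega1) s

/-- `Y` contains a subset order-isomorphic to `ω₁` (the image of a strictly increasing
`ω₁`-sequence). -/
noncomputable def ContainsOmega1Copy {X : Type u} [LinearOrder X] (Y : Set X) : Prop :=
  ∃ f : Ordinal.{0} → X, (∀ a < omega1, f a ∈ Y) ∧
    ∀ a b : Ordinal, a < omega1 → b < omega1 → a < b → f a < f b

/-- `Y` contains a subset order-isomorphic to `ω₁` with the reversed order. -/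
noncomputable def ContainsOmega1RevCopy {X : Type u} [LinearOrder X] (Y : Set X) : Prop :=
  ∃ f : Ordinal.{0} → X, (∀ a < omega1, f a ∈ Y) ∧
    ∀ a b : Ordinal, a < omega1 → b < omega1 → a < b → f b < f a

theorem countable_setOf_list {W : Type*} {C : Set W} (hC : C.Countable) :
    {l : List W | ∀ x ∈ l, x ∈ C}.Countable := by
  have := hC.to_subtype
  refine (countable_range fun l : List C => l.map Subtype.val).mono fun l hl => ?_
  exact ⟨l.attach.map fun x => ⟨x.1, hl x.1 x.2⟩, by simp⟩

/-- If all finite prefixes of `g` stabilize, then `g` is eventually constant. -/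
theorem exists_forall_ge_eq {W I : Type*} [LinearOrder I]
    (hI : ∀ C : Set I, C.Countable → BddAbove C) {g : I → Lex (ℕ → W)}
    (hg : ∀ n, ∃ a, ∀ b ≥ a, ∀ k < n, g b k = g a k) :
    ∃ a, ∀ b ≥ a, g b = g a := by
  choose a ha using hg
  obtain ⟨c, hc⟩ := hI _ (countable_range a)
  have hac (n) : a n ≤ c := hc ⟨n, rfl⟩
  refine ⟨c, fun b hb => ?_⟩
  funext k
  exact (ha (k + 1) b ((hac _).trans hb) k k.lt_succ_self).trans
    (ha (k + 1) c (hac _) k k.lt_succ_self).symm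

/-- A sequence either is eventually constant, or has a first coordinate that does not
stabilize. -/
theorem eventually_const_or_exists_first {W I : Type*} [LinearOrder I]
    (hI : ∀ C : Set I, C.Countable → BddAbove C) [Nonempty I] (g : I → Lex (ℕ → W)) :
    (∃ a, ∀ b ≥ a, g b = g a) ∨
      ∃ n a, (∀ b ≥ a, ∀ k < n, g b k = g a k) ∧ ∀ c ≥ a, ∃ b ≥ c, g b n ≠ g c n := by
  by_cases h : ∀ n, ∃ a, ∀ b ≥ a, ∀ k < n, g b k = g a k
  · exact Or.inl (exists_forall_ge_eq hI h)
  right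
  classical
  rw [not_forall] at h
  have hn := Nat.find_spec h
  have hmin := fun m => @Nat.find_min _ _ h m
  set n := Nat.find h
  cases hN : n with
  | zero =>
    rw [hN] at hn
    exact absurd ⟨Classical.arbitrary I, by simp⟩ hn
  | succ m =>
    rw [hN] at hn
    obtain ⟨a, ha⟩ := not_not.1 (hmin m (by omega))
    refine ⟨m, a, ha, fun c hc => ?_⟩
    by_contra! hcon
    refine hn ⟨c, fun b hb k hk => ?_⟩
    rcases Nat.lt_succ_iff_lt_or_eq.1 hk with hk | rfl
    · exact (ha b (hc.trans hb) k hk).trans (ha c hc k hk).symm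
    · exact hcon b hb

section LexSequences

variable {W : Type*} [LinearOrder W]

theorem lex_lt_iff {x y : Lex (ℕ → W)} :
    x < y ↔ ∃ i, (∀ j < i, x j = y j) ∧ x i < y i :=
  Iff.rfl

theorem lex_apply_le {x y : Lex (ℕ → W)} (h : x ≤ y) {n : ℕ} (hn : ∀ k < n, x k = y k) :
    x n ≤ y n := by
  by_contra! hlt
  exact h.not_gt (lex_lt_iff.2 ⟨n, fun j hj => (hn j hj).symm, hlt⟩)

/-- The finite sequence `l`, extended by `⊥`. -/
def padBot [OrderBot W] (l : List W) : Lex (ℕ → W) :=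
  toLex fun n => l.getD n ⊥

theorem padBot_apply [OrderBot W] (l : List W) (n : ℕ) : padBot l n = l.getD n ⊥ := rfl

theorem padBot_map_range_apply [OrderBot W] (f : ℕ → W) (n k : ℕ) :
    padBot ((List.range n).map f) k = if k < n then f k else ⊥ := by
  rw [padBot_apply]
  split_ifs with h
  · simp [List.getD, h]
  · simp [List.getD, h]

variable {I : Type*} [LinearOrder I]

theorem exists_forall_ge_eq_of_antitoneOn [WellFoundedLT W] {f : I → W} {a : I}
    (hf : AntitoneOn f (Ici a)) : ∃ b ≥ a, ∀ c ≥ b, f c = f b := by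
  have hne : (f '' Ici a).Nonempty := ⟨f a, a, le_rfl, rfl⟩
  obtain ⟨b, hb, hfb⟩ := WellFounded.min_mem wellFounded_lt (f '' Ici a) hne
  refine ⟨b, hb, fun c hc => le_antisymm (hf hb (le_trans hb hc) hc) ?_⟩
  rw [hfb]
  have hmem : f c ∈ f '' Ici a := ⟨c, le_trans hb hc, rfl⟩
  exact WellFounded.min_le wellFounded_lt hmem

theorem exists_forall_ge_eq_of_antitone [WellFoundedLT W] [Nonempty I]
    (hI : ∀ C : Set I, C.Countable → BddAbove C) {g : I → Lex (ℕ → W)} (hg : Antitone g) :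
    ∃ a, ∀ b ≥ a, g b = g a := by
  refine exists_forall_ge_eq hI fun n => ?_
  induction n with
  | zero => exact ⟨Classical.arbitrary I, by simp⟩
  | succ n ih =>
    obtain ⟨a, ha⟩ := ih
    have hmono : AntitoneOn (fun b => g b n) (Ici a) := fun b hb c hc hbc =>
      lex_apply_le (hg hbc) fun k hk => (ha c hc k hk).trans (ha b hb k hk).symm
    obtain ⟨b, hb, hbc⟩ := exists_forall_ge_eq_of_antitoneOn hmono
    refine ⟨b, fun c hc k hk => ?_⟩
    rcases Nat.lt_succ_iff_lt_or_eq.1 hk with hk | rfl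
    · exact (ha c (hb.trans hc) k hk).trans (ha b hb k hk).symm
    · exact hbc c hc

/-- A non-stabilizing monotone map into `WithTop Ω` is cofinal in `Ω`. -/
theorem exists_lt_of_monotoneOn {Ω : Type*} [LinearOrder Ω]
    (hI : ∀ C : Set I, C.Countable → BddAbove C) (hc : ∀ b : Ω, (Iic b).Countable)
    {f : I → WithTop Ω} {a : I} (hf : MonotoneOn f (Ici a))
    (hn : ∀ c ≥ a, ∃ b ≥ c, f b ≠ f c) :
    (∀ b ≥ a, f b < ⊤) ∧ ∀ w < (⊤ : WithTop Ω), ∃ b ≥ a, w < f b := by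
  constructor
  · intro b hb
    rw [lt_top_iff_ne_top]
    intro htop
    obtain ⟨c, hcb, hne⟩ := hn b hb
    refine hne (le_antisymm ?_ (hf hb (hb.trans hcb) hcb))
    rw [htop]
    exact le_top
  · intro w hw
    by_contra! hcon
    lift w to Ω using hw.ne
    have hcount : (f '' Ici a).Countable := by
      refine ((hc w).image ((↑) : Ω → WithTop Ω)).mono ?_
      rintro _ ⟨b, hb, rfl⟩
      obtain ⟨v, hv⟩ := WithTop.ne_top_iff_exists.1 ((hcon b hb).trans_lt hw).ne
      exact ⟨v, WithTop.coe_le_coe.1 (hv.trans_le (hcon b hb)), hv⟩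
    obtain ⟨t, hta, hft⟩ := exists_subset_bijOn (Ici a) f
    have htc : t.Countable := by
      refine Set.MapsTo.countable_of_injOn (f := f) (t := f '' Ici a) ?_ hft.injOn hcount
      exact hft.mapsTo
    obtain ⟨c, hcb⟩ := hI _ htc
    have hca : a ≤ c := by
      obtain ⟨s, hs, -⟩ := hft.surjOn ⟨a, le_refl a, rfl⟩
      exact (hta hs).trans (hcb hs)
    obtain ⟨b, hb, hne⟩ := hn c hca
    obtain ⟨s, hs, hsb⟩ := hft.surjOn ⟨b, hca.trans hb, rfl⟩
    refine hne (le_antisymm ?_ (hf hca (hca.trans hb) hb))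
    rw [← hsb]
    exact hf (hta hs) hca (hcb hs)

end LexSequences

theorem exists_strictMono_of_not_countable {Ω : Type*} [LinearOrder Ω] [WellFoundedLT Ω]
    (hc : ∀ b : Ω, (Iic b).Countable) {U : Set Ω} (hU : ¬ U.Countable)
    (hb : ∀ C : Set Ω, C.Countable → BddAbove C) : ∃ f : Ω → Ω, StrictMono f ∧ ∀ a, f a ∈ U := by
  have key (C : Set Ω) (hC : C.Countable) : ∃ u ∈ U, ∀ c ∈ C, c < u := by
    obtain ⟨b, hCb⟩ := hb C hC
    by_contra! hcon
    refine hU ((hc b).mono fun u hu => ?_)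
    obtain ⟨c, hcC, huc⟩ := hcon u hu
    exact huc.trans (hCb hcC)
  have hcount (a : Ω) (F : ∀ b, b < a → Ω) : {x | ∃ b h, F b h = x}.Countable := by
    have := ((hc a).mono Iio_subset_Iic_self).to_subtype
    refine (countable_range fun b : Iio a => F b.1 b.2).mono ?_
    rintro _ ⟨b, h, rfl⟩
    exact ⟨⟨b, h⟩, rfl⟩
  let f : Ω → Ω := wellFounded_lt.fix fun a F => (key _ (hcount a F)).choose
  have hf (a) : f a = (key _ (hcount a fun b _ => f b)).choose := wellFounded_lt.fix_eq _ a
  refine ⟨f, fun b a hba => ?_, fun a => ?_⟩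
  · rw [hf a]
    exact (key _ (hcount a fun b _ => f b)).choose_spec.2 _ ⟨b, hba, rfl⟩
  · rw [hf a]
    exact (key _ (hcount a fun b _ => f b)).choose_spec.1
section LadderLine

variable {Ω : Type} [LinearOrder Ω] [OrderBot Ω]

/-- `δ` is a limit of a strictly increasing sequence. -/
def IsSeqLimit (δ : Ω) : Prop :=
  ∃ s : ℕ → Ω, StrictMono s ∧ IsLUB (range s) δ

open Classical in
/-- A strictly increasing sequence converging to `δ` if there is one, and `⊥` otherwise. -/
noncomputable def ladder (δ : Ω) : ℕ → WithTop Ω :=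
  if h : IsSeqLimit δ then fun n => (h.choose n : WithTop Ω) else fun _ => ⊥

theorem exists_ladder_eq {δ : Ω} (h : IsSeqLimit δ) :
    ∃ s : ℕ → Ω, StrictMono s ∧ IsLUB (range s) δ ∧ ∀ n, ladder δ n = s n :=
  ⟨h.choose, h.choose_spec.1, h.choose_spec.2, fun n => by rw [ladder, dif_pos h]⟩

theorem ladder_of_not {δ : Ω} (h : ¬ IsSeqLimit δ) : toLex (ladder δ) = padBot [] := by
  rw [ladder, dif_neg h]
  rfl

theorem ladder_injOn : InjOn (fun δ : Ω => toLex (ladder δ)) {δ | IsSeqLimit δ} := by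
  intro δ hδ ε hε h
  obtain ⟨s, -, hs, hsl⟩ := exists_ladder_eq hδ
  obtain ⟨t, -, ht, htl⟩ := exists_ladder_eq hε
  have : s = t := by
    funext n
    have := congrFun (toLex.injective h) n
    rw [hsl, htl] at this
    exact WithTop.coe_injective this
  exact hs.unique (this ▸ ht)

variable (Ω) in
/-- The sequences in `WithTop Ω` that are finitely supported or one of the chosen ladders,
ordered lexicographically. -/
abbrev LadderLine : Type :=
  {x : Lex (ℕ → WithTop Ω) // x ∈ range (padBot (W := WithTop Ω)) ∪
    range fun δ : Ω => toLex (ladder δ)}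

/-- The finite sequence `l` as a point of the ladder line. -/
def LadderLine.ofList (l : List (WithTop Ω)) : LadderLine Ω :=
  ⟨padBot l, Or.inl ⟨l, rfl⟩⟩

/-- The ladder at `δ` as a point of the ladder line. -/
noncomputable def LadderLine.ofLimit (δ : Ω) : LadderLine Ω :=
  ⟨toLex (ladder δ), Or.inr ⟨δ, rfl⟩⟩

theorem mk_ladderLine_le (hΩ : Cardinal.mk Ω ≤ Cardinal.aleph 1) :
    Cardinal.mk (LadderLine Ω) ≤ Cardinal.aleph 1 := by
  have h0 : Cardinal.aleph0 ≤ Cardinal.aleph 1 := Cardinal.aleph0_le_aleph 1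
  refine (Cardinal.mk_union_le _ _).trans (Cardinal.add_le_of_le h0 ?_ ?_)
  · refine Cardinal.mk_range_le.trans ((Cardinal.mk_list_le_max _).trans (max_le h0 ?_))
    have : Cardinal.mk (WithTop Ω) = Cardinal.mk Ω + 1 := Cardinal.mk_option
    rw [this]
    exact Cardinal.add_le_of_le h0 hΩ (Cardinal.one_le_aleph0.trans h0)
  · exact Cardinal.mk_range_le.trans hΩ

theorem LadderLine.exists_isGLB [WellFoundedLT Ω] {I : Type*} [LinearOrder I] [Nonempty I]
    (hI : ∀ C : Set I, C.Countable → BddAbove C) {g : I → LadderLine Ω} (hg : Antitone g) :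
    ∃ s, IsGLB (range g) s := by
  obtain ⟨a, ha⟩ := exists_forall_ge_eq_of_antitone hI (g := fun i => (g i).1) hg
  refine ⟨g a, ?_, fun u hu => hu ⟨a, rfl⟩⟩
  rintro _ ⟨b, rfl⟩
  rcases le_total a b with h | h
  · exact (Subtype.ext (ha b h)).ge
  · exact hg h

theorem LadderLine.exists_isLUB {I : Type*} [LinearOrder I] [Nonempty I]
    (hI : ∀ C : Set I, C.Countable → BddAbove C) (hc : ∀ b : Ω, (Iic b).Countable)
    {g : I → LadderLine Ω} (hg : Monotone g) : ∃ s, IsLUB (range g) s := by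
  rcases eventually_const_or_exists_first hI (fun i => (g i).1) with ⟨a, ha⟩ | ⟨n, a, ha, hn⟩
  · refine ⟨g a, ?_, fun u hu => hu ⟨a, rfl⟩⟩
    rintro _ ⟨b, rfl⟩
    rcases le_total a b with h | h
    · exact (Subtype.ext (ha b h)).le
    · exact hg h
  have hmono : MonotoneOn (fun b => (g b).1 n) (Ici a) := fun b hb c hc hbc =>
    lex_apply_le (hg hbc) fun k hk => (ha b hb k hk).trans (ha c hc k hk).symm
  obtain ⟨htop, hcof⟩ := exists_lt_of_monotoneOn hI hc hmono hn
  let f : ℕ → WithTop Ω := fun k => if k < n then (g a).1 k else ⊤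
  let l := (List.range (n + 1)).map f
  have hlt (k : ℕ) (hk : k < n) : padBot l k = (g a).1 k := by
    rw [padBot_map_range_apply, if_pos (by omega)]
    exact if_pos hk
  have hln : padBot l n = ⊤ := by
    rw [padBot_map_range_apply, if_pos (by omega)]
    exact if_neg (lt_irrefl n)
  refine ⟨ofList l, ?_, fun u hu => ?_⟩
  · rintro _ ⟨b, rfl⟩
    have hmax : g b ≤ g (max a b) := hg (le_max_right a b)
    refine hmax.trans (le_of_lt ?_)
    refine lex_lt_iff.2 ⟨n, fun j hj => ?_, ?_⟩
    · exact (ha _ (le_max_left a b) j hj).trans (hlt j hj).symm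
    · change _ < padBot l n
      rw [hln]
      exact htop _ (le_max_left a b)
  · by_contra! hul
    obtain ⟨i, hi, hui⟩ := lex_lt_iff.1 (show u.1 < padBot l from hul)
    rcases lt_trichotomy i n with h | rfl | h
    · refine (hu ⟨a, rfl⟩).not_gt (lex_lt_iff.2 ⟨i, fun j hj => ?_, ?_⟩)
      · rw [hi j hj, hlt j (hj.trans h)]
      · rwa [← hlt i h]
    · rw [hln] at hui
      obtain ⟨b, hb, hub⟩ := hcof _ hui
      refine (hu ⟨b, rfl⟩).not_gt (lex_lt_iff.2 ⟨i, fun j hj => ?_, hub⟩)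
      rw [hi j hj, hlt j hj]
      exact (ha b hb j hj).symm
    · rw [padBot_map_range_apply, if_neg (by omega)] at hui
      exact not_lt_bot hui

/-- An uncountable subset of the ladder line has uncountable branching at some finite prefix. -/
theorem LadderLine.exists_not_countable_branching (hc : ∀ b : Ω, (Iic b).Countable)
    (hb : ∀ C : Set Ω, C.Countable → BddAbove C) {Y : Set (LadderLine Ω)} (hY : ¬ Y.Countable) :
    ∃ (n : ℕ) (a : ℕ → WithTop Ω),
      ¬ {w | ∃ y ∈ Y, (∀ k < n, y.1 k = a k) ∧ y.1 n = w}.Countable := by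
  by_contra! hcon
  have hpre (n : ℕ) : ((fun y : LadderLine Ω => (List.range n).map y.1) '' Y).Countable := by
    induction n with
    | zero => exact (countable_singleton []).mono (by rintro _ ⟨y, -, rfl⟩; rfl)
    | succ n ih =>
      have := ih.biUnion fun p _ => (hcon n (padBot p)).image fun w => p ++ [w]
      refine this.mono ?_
      rintro _ ⟨y, hy, rfl⟩
      refine mem_biUnion ⟨y, hy, rfl⟩ ⟨y.1 n, ⟨y, hy, fun k hk => ?_, rfl⟩, ?_⟩
      · exact ((padBot_map_range_apply _ _ _).trans (if_pos hk)).symm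
      · change _ = List.map (ofLex y.1) (List.range (n + 1))
        rw [List.range_succ, List.map_append]
        rfl
  let C : Set (WithTop Ω) := {w | ∃ y ∈ Y, ∃ n, y.1 n = w}
  have hC : C.Countable := by
    have := countable_iUnion fun n : ℕ => (hpre (n + 1)).image fun p => padBot p n
    refine this.mono ?_
    rintro _ ⟨y, hy, n, rfl⟩
    refine mem_iUnion.2 ⟨n, _, ⟨y, hy, rfl⟩, ?_⟩
    exact (padBot_map_range_apply _ _ _).trans (if_pos n.lt_succ_self)
  obtain ⟨b, hbC⟩ := hb _ (hC.preimage (f := ((↑) : Ω → WithTop Ω)) WithTop.coe_injective)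
  have h1 := (countable_setOf_list (hC.insert ⊥)).image (ofList (Ω := Ω))
  have h2 := (hc b).image (ofLimit (Ω := Ω))
  refine hY (((h1.union h2).insert (ofList [])).mono fun y hy => ?_)
  obtain ⟨x, ⟨l, rfl⟩ | ⟨δ, rfl⟩⟩ := y
  · refine Or.inr (Or.inl ⟨l, fun w hw => ?_, rfl⟩)
    obtain ⟨n, hn, rfl⟩ := List.getElem_of_mem hw
    exact Or.inr ⟨_, hy, n, by simp [padBot_apply, List.getD, hn]⟩
  · by_cases hδ : IsSeqLimit δ
    · obtain ⟨s, -, hs, hsl⟩ := exists_ladder_eq hδ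
      refine Or.inr (Or.inr ⟨δ, hs.2 ?_, rfl⟩)
      rintro _ ⟨n, rfl⟩
      exact hbC ⟨_, hy, n, hsl n⟩
    · exact Or.inl (Subtype.ext (ladder_of_not hδ))

theorem LadderLine.exists_strictMono [WellFoundedLT Ω] (hc : ∀ b : Ω, (Iic b).Countable)
    (hb : ∀ C : Set Ω, C.Countable → BddAbove C) {Y : Set (LadderLine Ω)} (hY : ¬ Y.Countable) :
    ∃ f : Ω → LadderLine Ω, StrictMono f ∧ ∀ a, f a ∈ Y := by
  obtain ⟨n, a, hn⟩ := exists_not_countable_branching hc hb hY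
  set B := {w | ∃ y ∈ Y, (∀ k < n, y.1 k = a k) ∧ y.1 n = w}
  have hU : ¬ (((↑) : Ω → WithTop Ω) ⁻¹' B).Countable := by
    intro h
    refine hn (((h.image ((↑) : Ω → WithTop Ω)).insert ⊤).mono fun w hw => ?_)
    induction w with
    | top => exact Or.inl rfl
    | coe w => exact Or.inr ⟨w, hw, rfl⟩
  obtain ⟨f, hf, hfU⟩ := exists_strictMono_of_not_countable hc hU hb
  choose y hyY hya hyn using hfU
  refine ⟨y, fun b c hbc => lex_lt_iff.2 ⟨n, fun j hj => ?_, ?_⟩, hyY⟩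
  · rw [hya b j hj, hya c j hj]
  · rw [hyn, hyn]
    exact WithTop.coe_lt_coe.2 (hf hbc)

end LadderLine
section FinalSegments

variable {X : Type u} [LinearOrder X]

theorem isCompact_setOf_finalSegs :
    IsCompact {F : X → Bool | ∀ x y : X, x ≤ y → F x = true → F y = true} := by
  refine IsClosed.isCompact ?_
  simp only [ofPred_forall]
  refine isClosed_iInter fun x => isClosed_iInter fun y => isClosed_iInter fun _ => ?_
  have : {F : X → Bool | F x = true → F y = true} = {F | F x = true}ᶜ ∪ {F | F y = true} := by
    ext F
    simp [imp_iff_not_or]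
  rw [this]
  have hclopen (z : X) : IsClopen {F : X → Bool | F z = true} :=
    (isClopen_discrete {true}).preimage (continuous_apply z)
  exact (hclopen x).compl.isClosed.union (hclopen y).isClosed

instance : CompactSpace (FinalSegs X) :=
  isCompact_iff_compactSpace.1 isCompact_setOf_finalSegs

/-- The final segment `[z, →)`. -/
def finalSegIci (z : X) : FinalSegs X :=
  ⟨fun w => decide (z ≤ w), fun x y hxy hx => by
    simp only [decide_eq_true_eq] at *
    exact hx.trans hxy⟩

/-- The final segment `(z, →)`. -/
def finalSegIoi (z : X) : FinalSegs X :=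
  ⟨fun w => decide (z < w), fun x y hxy hx => by
    simp only [decide_eq_true_eq] at *
    exact hx.trans_le hxy⟩

theorem finalSegIci_ne_finalSegIoi (z : X) : finalSegIci z ≠ finalSegIoi z := by
  intro h
  simpa [finalSegIci, finalSegIoi] using congrFun (congrArg Subtype.val h) z

theorem finalSegIci_apply_eq {z w : X} (h : z ≠ w) :
    (finalSegIci z).1 w = (finalSegIoi z).1 w := by
  simp [finalSegIci, finalSegIoi, le_iff_lt_or_eq, h]

/-- A continuous real function separates only countably many jumps `[z, →)`, `(z, →)`. -/
theorem countable_setOf_finalSeg_ne {f : FinalSegs X → ℝ} (hf : Continuous f) :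
    {z | f (finalSegIci z) ≠ f (finalSegIoi z)}.Countable := by
  have hunif : UniformContinuous f := CompactSpace.uniformContinuous_of_continuous hf
  have hjump : Tendsto (fun z : X => (finalSegIci z, finalSegIoi z)) cofinite
      (uniformity (FinalSegs X)) := by
    rw [uniformity_subtype, tendsto_comap_iff, Pi.uniformity, tendsto_iInf]
    intro w
    rw [tendsto_comap_iff]
    refine tendsto_def.2 fun s hs => ?_
    filter_upwards [(finite_singleton w).compl_mem_cofinite] with z hz
    change ((finalSegIci z).1 w, (finalSegIoi z).1 w) ∈ s
    rw [finalSegIci_apply_eq (by simpa using hz)]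
    exact refl_mem_uniformity hs
  have hdist := Tendsto.comp hunif hjump
  have hfin (n : ℕ) :
      {z | ¬ dist (f (finalSegIci z)) (f (finalSegIoi z)) < 1 / (n + 1 : ℝ)}.Finite :=
    hdist (Metric.dist_mem_uniformity Nat.one_div_pos_of_nat)
  refine (countable_iUnion fun n => (hfin n).countable).mono fun z hz => ?_
  obtain ⟨n, hn⟩ := exists_nat_one_div_lt (dist_pos.2 hz)
  exact mem_iUnion.2 ⟨n, hn.not_gt⟩

theorem isOpen_setOf_finalSeg_separating (x y : X) :
    IsOpen {F : FinalSegs X | F.1 x = false ∧ F.1 y = true} := by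
  have hopen (z : X) (b : Bool) : IsOpen {F : FinalSegs X | F.1 z = b} :=
    (isOpen_discrete {b}).preimage
      (f := fun F : FinalSegs X => F.1 z) ((continuous_apply z).comp continuous_subtype_val)
  exact (hopen x false).inter (hopen y true)

/-- Final segments cut between consecutive terms of a sequence increasing to `z` converge
to `[z, →)`. -/
theorem tendsto_finalSegIci {z : X} {a b : ℕ → X} {F : ℕ → FinalSegs X}
    (ha : ∀ w < z, ∀ᶠ n in atTop, w < a n) (hb : ∀ n, b n ≤ z)
    (hFa : ∀ n, (F n).1 (a n) = false) (hFb : ∀ n, (F n).1 (b n) = true) :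
    Tendsto F atTop (𝓝 (finalSegIci z)) := by
  rw [tendsto_subtype_rng, tendsto_pi_nhds]
  intro w
  refine tendsto_nhds_of_eventually_eq ?_
  rcases lt_or_ge w z with h | h
  · filter_upwards [ha w h] with n hn
    have : ¬ z ≤ w := h.not_ge
    simp only [finalSegIci, this, decide_false]
    by_contra hcon
    have := (F n).2 _ _ hn.le (by simpa using hcon)
    simp [hFa] at this
  · refine Eventually.of_forall fun n => ?_
    simp only [finalSegIci, h, decide_true]
    exact (F n).2 _ _ ((hb n).trans h) (hFb n)

/-- Final segments cut between consecutive terms of a sequence decreasing to `z` converge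
to `(z, →)`. -/
theorem tendsto_finalSegIoi {z : X} {a b : ℕ → X} {F : ℕ → FinalSegs X}
    (hb : ∀ w > z, ∀ᶠ n in atTop, b n < w) (ha : ∀ n, z ≤ a n)
    (hFa : ∀ n, (F n).1 (a n) = false) (hFb : ∀ n, (F n).1 (b n) = true) :
    Tendsto F atTop (𝓝 (finalSegIoi z)) := by
  rw [tendsto_subtype_rng, tendsto_pi_nhds]
  intro w
  refine tendsto_nhds_of_eventually_eq ?_
  rcases lt_or_ge z w with h | h
  · filter_upwards [hb w h] with n hn
    simp only [finalSegIoi, h, decide_true]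
    exact (F n).2 _ _ hn.le (hFb n)
  · refine Eventually.of_forall fun n => ?_
    have hw : ¬ z < w := h.not_gt
    simp only [finalSegIoi, hw, decide_false]
    by_contra hcon
    have := (F n).2 _ _ (h.trans (ha n)) (by simpa using hcon)
    simp [hFa] at this

end FinalSegments

section NotValdivia

variable {Ω : Type} [LinearOrder Ω]

/-- Every assignment of countable sets to pairs of finite sequences admits a sequential limit
`δ` that lies in no set assigned to sequences below `δ`. -/
theorem exists_isSeqLimit_forall_notMem [WellFoundedLT Ω] [NoMaxOrder Ω] [Nonempty Ω]
    (hc : ∀ b : Ω, (Iic b).Countable)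
    (hb : ∀ C : Set Ω, C.Countable → BddAbove C)
    (N : List (WithTop Ω) → List (WithTop Ω) → Set Ω) (hN : ∀ l m, (N l m).Countable) :
    ∃ δ : Ω, IsSeqLimit δ ∧ ∀ l m : List (WithTop Ω), (∀ x ∈ l, x < (δ : WithTop Ω)) →
      (∀ x ∈ m, x < (δ : WithTop Ω)) → δ ∉ N l m := by
  have hstep (e : Ω) : ∃ e' > e, ∀ l m : List (WithTop Ω), (∀ x ∈ l, x < e) →
      (∀ x ∈ m, x < e) → ∀ ε ∈ N l m, ε < e' := by
    have hlists : {l : List (WithTop Ω) | ∀ x ∈ l, x ∈ Iio (e : WithTop Ω)}.Countable := by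
      refine countable_setOf_list (((hc e).image ((↑) : Ω → WithTop Ω)).mono fun w hw => ?_)
      obtain ⟨v, hv⟩ := WithTop.ne_top_iff_exists.1 (mem_Iio.1 hw).ne_top
      exact ⟨v, WithTop.coe_le_coe.1 (hv.trans_le hw.le), hv⟩
    obtain ⟨c, hcb⟩ := hb _ ((hlists.biUnion fun l _ => hlists.biUnion fun m _ => hN l m).insert e)
    obtain ⟨e', he'⟩ := exists_gt c
    refine ⟨e', (hcb (Or.inl rfl)).trans_lt he', fun l m hl hm ε hε => (hcb ?_).trans_lt he'⟩
    exact Or.inr (mem_biUnion hl (mem_biUnion hm hε))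
  choose e' he' hNe' using hstep
  let e : ℕ → Ω := fun n => e'^[n] (Classical.arbitrary Ω)
  have he_succ (n : ℕ) : e (n + 1) = e' (e n) := Function.iterate_succ_apply' _ _ _
  have he : StrictMono e := strictMono_nat_of_lt_succ fun n => by
    rw [he_succ]
    exact he' _
  have hne : (upperBounds (range e)).Nonempty := hb _ (countable_range e)
  have hδ : IsLUB (range e) (WellFounded.min wellFounded_lt _ hne) := by
    refine ⟨WellFounded.min_mem _ _ hne, fun u hu => ?_⟩
    exact WellFounded.min_le wellFounded_lt hu
  set δ := WellFounded.min wellFounded_lt _ hne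
  have hbelow (l : List (WithTop Ω)) (hl : ∀ x ∈ l, x < (δ : WithTop Ω)) :
      ∃ n, ∀ x ∈ l, x < e n := by
    have hev : ∀ x ∈ l, ∀ᶠ n in atTop, x < e n := by
      intro x hx
      have hxδ := hl x hx
      lift x to Ω using ne_top_of_lt hxδ
      obtain ⟨_, ⟨n, rfl⟩, hn⟩ := (lt_isLUB_iff hδ).1 (WithTop.coe_lt_coe.1 hxδ)
      filter_upwards [eventually_ge_atTop n] with k hk
      exact WithTop.coe_lt_coe.2 (hn.trans_le (he.monotone hk))
    have : ∀ᶠ n in atTop, ∀ x ∈ l, x < e n := by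
      simpa using (eventually_all_finite (l.finite_toSet)).2 hev
    exact this.exists
  refine ⟨δ, ⟨e, he, hδ⟩, fun l m hl hm hmem => ?_⟩
  obtain ⟨i, hi⟩ := hbelow l hl
  obtain ⟨j, hj⟩ := hbelow m hm
  have hi' : ∀ x ∈ l, x < e (max i j) := fun x hx =>
    (hi x hx).trans_le (WithTop.coe_le_coe.2 (he.monotone (le_max_left i j)))
  have hj' : ∀ x ∈ m, x < e (max i j) := fun x hx =>
    (hj x hx).trans_le (WithTop.coe_le_coe.2 (he.monotone (le_max_right i j)))
  have := hNe' _ l m hi' hj' δ hmem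
  rw [← he_succ] at this
  exact this.not_ge (hδ.1 ⟨_, rfl⟩)

variable [OrderBot Ω]

/-- A ladder is a two-sided limit of intervals between finite sequences below it. -/
theorem LadderLine.exists_lists_tendsto {δ : Ω} (hδ : IsSeqLimit δ) :
    ∃ S T : ℕ → List (WithTop Ω), (∀ n, ∀ x ∈ S n, x < (δ : WithTop Ω)) ∧
      (∀ n, ∀ x ∈ T n, x < (δ : WithTop Ω)) ∧
      (∀ n, ofList (S n) < ofList (S (n + 1))) ∧ (∀ n, ofList (T (n + 1)) < ofList (T n)) ∧
      (∀ n, ofList (S n) ≤ ofLimit δ) ∧ (∀ n, ofLimit δ ≤ ofList (T n)) ∧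
      (∀ w < ofLimit δ, ∀ᶠ n in atTop, w < ofList (S n)) ∧
      ∀ w > ofLimit δ, ∀ᶠ n in atTop, ofList (T n) < w := by
  obtain ⟨s, hs, hsδ, hsl⟩ := exists_ladder_eq hδ
  have hlt (n : ℕ) : s n < δ := (hs n.lt_succ_self).trans_le (hsδ.1 ⟨_, rfl⟩)
  let t (n k : ℕ) : WithTop Ω := if k = n then (s (n + 1) : WithTop Ω) else s k
  let S (n : ℕ) := (List.range (n + 1)).map fun k => (s k : WithTop Ω)
  let T (n : ℕ) := (List.range (n + 1)).map (t n)
  have hS (n k : ℕ) : padBot (S n) k = if k < n + 1 then (s k : WithTop Ω) else ⊥ :=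
    padBot_map_range_apply _ _ _
  have hT (n k : ℕ) : padBot (T n) k = if k < n + 1 then t n k else ⊥ :=
    padBot_map_range_apply _ _ _
  have hpos (n : ℕ) : (⊥ : WithTop Ω) < s (n + 1) :=
    bot_le.trans_lt (WithTop.coe_lt_coe.2 (hs n.succ_pos))
  have hsn (n : ℕ) : (s n : WithTop Ω) < s (n + 1) := WithTop.coe_lt_coe.2 (hs n.lt_succ_self)
  refine ⟨S, T, ?_, ?_, ?_, ?_, ?_, ?_, ?_, ?_⟩
  · intro n x hx
    obtain ⟨k, -, rfl⟩ := List.mem_map.1 hx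
    exact WithTop.coe_lt_coe.2 (hlt k)
  · intro n x hx
    obtain ⟨k, -, rfl⟩ := List.mem_map.1 hx
    simp only [t]
    split_ifs
    exacts [WithTop.coe_lt_coe.2 (hlt _), WithTop.coe_lt_coe.2 (hlt _)]
  · refine fun n => lex_lt_iff.2 ⟨n + 1, fun j hj => ?_, ?_⟩
    · change padBot (S n) j = padBot (S (n + 1)) j
      rw [hS, hS, if_pos hj, if_pos (by omega)]
    · change padBot (S n) (n + 1) < padBot (S (n + 1)) (n + 1)
      rw [hS, hS, if_neg (by omega), if_pos (by omega)]
      exact hpos n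
  · refine fun n => lex_lt_iff.2 ⟨n, fun j hj => ?_, ?_⟩
    · change padBot (T (n + 1)) j = padBot (T n) j
      rw [hT, hT, if_pos (by omega), if_pos (by omega)]
      simp only [t]
      rw [if_neg (by omega), if_neg (by omega)]
    · change padBot (T (n + 1)) n < padBot (T n) n
      rw [hT, hT, if_pos (by omega), if_pos (by omega)]
      simp only [t]
      rw [if_neg (by omega), if_pos trivial]
      exact hsn n
  · refine fun n => le_of_lt (lex_lt_iff.2 ⟨n + 1, fun j hj => ?_, ?_⟩)
    · change padBot (S n) j = ladder δ j
      rw [hS, hsl, if_pos hj]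
    · change padBot (S n) (n + 1) < ladder δ (n + 1)
      rw [hS, hsl, if_neg (by omega)]
      exact hpos n
  · refine fun n => le_of_lt (lex_lt_iff.2 ⟨n, fun j hj => ?_, ?_⟩)
    · change ladder δ j = padBot (T n) j
      rw [hT, hsl, if_pos (by omega)]
      exact (if_neg (by omega)).symm
    · change ladder δ n < padBot (T n) n
      rw [hT, hsl, if_pos (by omega)]
      simp only [t]
      rw [if_pos trivial]
      exact hsn n
  · intro w hw
    obtain ⟨i, hi, hwi⟩ := lex_lt_iff.1 (show w.1 < toLex (ladder δ) from hw)
    filter_upwards [eventually_ge_atTop i] with n hn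
    refine lex_lt_iff.2 ⟨i, fun j hj => ?_, ?_⟩
    · change w.1 j = padBot (S n) j
      rw [hi j hj, hS, if_pos (by omega)]
      exact hsl j
    · change w.1 i < padBot (S n) i
      rw [hS, if_pos (by omega), ← hsl]
      exact hwi
  · intro w hw
    obtain ⟨i, hi, hwi⟩ := lex_lt_iff.1 (show toLex (ladder δ) < w.1 from hw)
    filter_upwards [eventually_gt_atTop i] with n hn
    refine lex_lt_iff.2 ⟨i, fun j hj => ?_, ?_⟩
    · change padBot (T n) j = w.1 j
      rw [← hi j hj, hT, if_pos (by omega)]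
      simp only [t]
      rw [if_neg (by omega)]
      exact (hsl j).symm
    · change padBot (T n) i < w.1 i
      rw [hT, if_pos (by omega)]
      simp only [t]
      rw [if_neg (by omega), ← hsl]
      exact hwi

theorem LadderLine.not_isValdivia [WellFoundedLT Ω] [NoMaxOrder Ω]
    (hc : ∀ b : Ω, (Iic b).Countable) (hb : ∀ C : Set Ω, C.Countable → BddAbove C) :
    ¬ IsValdivia (FinalSegs (LadderLine Ω)) := by
  rintro ⟨Γ, h, hemb, hdense⟩
  have hcont (γ : Γ) : Continuous fun F => h F γ := (continuous_apply γ).comp hemb.continuous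
  have hpick (l m : List (WithTop Ω)) : ∃ F : FinalSegs (LadderLine Ω),
      {γ | h F γ ≠ 0}.Countable ∧
        (ofList l < ofList m → F.1 (ofList l) = false ∧ F.1 (ofList m) = true) := by
    by_cases hlm : ofList l < ofList m
    · obtain ⟨F, hF, hFD⟩ := hdense.exists_mem_open
        (isOpen_setOf_finalSeg_separating (ofList l) (ofList m))
        ⟨finalSegIci (ofList m), by simp [finalSegIci, hlm]⟩
      exact ⟨F, hF, fun _ => hFD⟩
    · have : Nonempty (FinalSegs (LadderLine Ω)) := ⟨finalSegIci (ofList [])⟩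
      obtain ⟨F, hF⟩ := hdense.nonempty
      exact ⟨F, hF, fun hlm' => absurd hlm' hlm⟩
  choose d hd hdsep using hpick
  let N (l m : List (WithTop Ω)) : Set Ω := {δ | IsSeqLimit δ ∧ ∃ γ, h (d l m) γ ≠ 0 ∧
    h (finalSegIci (ofLimit δ)) γ ≠ h (finalSegIoi (ofLimit δ)) γ}
  have hN (l m : List (WithTop Ω)) : (N l m).Countable := by
    have hjumps := (hd l m).biUnion fun γ _ => countable_setOf_finalSeg_ne (hcont γ)
    refine Set.MapsTo.countable_of_injOn (f := ofLimit) ?_ ?_ hjumps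
    · rintro δ ⟨-, γ, hγ, hδγ⟩
      exact mem_biUnion hγ hδγ
    · intro δ hδ ε hε hδε
      exact ladder_injOn hδ.1 hε.1 (congrArg Subtype.val hδε)
  obtain ⟨δ, hδ, hδN⟩ := exists_isSeqLimit_forall_notMem hc hb N hN
  obtain ⟨S, T, hSδ, hTδ, hS, hT, hSle, hTle, hSlim, hTlim⟩ := exists_lists_tendsto hδ
  have hlow : Tendsto (fun n => d (S n) (S (n + 1))) atTop (𝓝 (finalSegIci (ofLimit δ))) :=
    tendsto_finalSegIci hSlim (fun n => hSle (n + 1)) (fun n => (hdsep _ _ (hS n)).1)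
      fun n => (hdsep _ _ (hS n)).2
  have hupp : Tendsto (fun n => d (T (n + 1)) (T n)) atTop (𝓝 (finalSegIoi (ofLimit δ))) :=
    tendsto_finalSegIoi hTlim (fun n => hTle (n + 1)) (fun n => (hdsep _ _ (hT n)).1)
      fun n => (hdsep _ _ (hT n)).2
  refine finalSegIci_ne_finalSegIoi (ofLimit δ) (hemb.injective ?_)
  funext γ
  by_contra hγ
  have hzero (l m : List (WithTop Ω)) (hl : ∀ x ∈ l, x < (δ : WithTop Ω))
      (hm : ∀ x ∈ m, x < (δ : WithTop Ω)) : h (d l m) γ = 0 := by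
    by_contra hne
    exact hδN l m hl hm ⟨hδ, γ, hne, hγ⟩
  have hlow' := ((hcont γ).tendsto _).comp hlow
  have hupp' := ((hcont γ).tendsto _).comp hupp
  refine hγ ((tendsto_nhds_unique (b := 0) hlow' ?_).trans (tendsto_nhds_unique hupp' ?_).symm)
  · exact tendsto_nhds_of_eventually_eq
      (Eventually.of_forall fun n => hzero _ _ (hSδ n) (hSδ (n + 1)))
  · exact tendsto_nhds_of_eventually_eq
      (Eventually.of_forall fun n => hzero _ _ (hTδ (n + 1)) (hTδ n))

end NotValdivia

theorem omega1_eq_omega_one : omega1 = Ordinal.omega 1 :=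
  Cardinal.ord_aleph 1

theorem bddAbove_of_countable_omega1 {C : Set (Iio omega1)} (hC : C.Countable) : BddAbove C := by
  have := hC.to_subtype
  have hlt : ⨆ c : C, (c.1 : Ordinal) < Ordinal.omega 1 :=
    Ordinal.iSup_lt_omega_one fun c => c.1.2.trans_eq omega1_eq_omega_one
  exact ⟨⟨_, hlt.trans_eq omega1_eq_omega_one.symm⟩, fun c hc =>
    Ordinal.le_iSup (fun c : C => (c.1 : Ordinal)) ⟨c, hc⟩⟩

theorem countable_Iic_omega1 (b : omega1.ToType) : (Iic b).Countable := by
  have h : (Iio b).Countable := by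
    rw [← Cardinal.le_aleph0_iff_set_countable, ← Order.lt_succ_iff, Cardinal.succ_aleph0]
    have h1 : Cardinal.mk omega1.ToType = Cardinal.aleph 1 := Cardinal.mk_ord_toType _
    rw [← h1]
    refine Cardinal.mk_Iio_lt b ?_
    rw [h1, Ordinal.type_toType, omega1]
  rw [← Iio_insert]
  exact h.insert b

theorem exists_counterexample :
    ∃ (Z : Type) (iZ : LinearOrder Z),
      Cardinal.mk Z ≤ Cardinal.aleph 1 ∧
      @HasOmega1Sups Z iZ ∧ @HasOmega1Infs Z iZ ∧
      (∀ Y : Set Z, ¬ Y.Countable →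
        @ContainsOmega1Copy Z iZ Y ∨ @ContainsOmega1RevCopy Z iZ Y) ∧
      ¬ IsValdivia (@FinalSegs Z iZ) := by
  have hI : ∀ C : Set (Iio omega1), C.Countable → BddAbove C :=
    fun C => bddAbove_of_countable_omega1
  have e : Iio omega1 ≃o omega1.ToType := Ordinal.ToType.mk
  have hb : ∀ C : Set omega1.ToType, C.Countable → BddAbove C := fun C hC => by
    obtain ⟨b, hbC⟩ := hI _ (hC.preimage e.injective)
    exact ⟨e b, fun c hc => e.symm_apply_le.1 (hbC (by simpa using hc))⟩
  have hpos : 0 < omega1 := by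
    rw [omega1_eq_omega_one]
    exact Ordinal.omega_pos 1
  have hΩ : Cardinal.mk omega1.ToType = Cardinal.aleph 1 := Cardinal.mk_ord_toType _
  have : NoMaxOrder omega1.ToType := Cardinal.noMaxOrder (Cardinal.aleph0_le_aleph 1)
  have : Nonempty (Iio omega1) := ⟨⟨0, hpos⟩⟩
  have : Nonempty omega1.ToType := this.map e
  let _ : OrderBot omega1.ToType := WellFoundedLT.toOrderBot _
  refine ⟨LadderLine omega1.ToType, inferInstance, mk_ladderLine_le hΩ.le, ?_, ?_, ?_,
    LadderLine.not_isValdivia countable_Iic_omega1 hb⟩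
  · intro g hg _
    rw [image_eq_range]
    exact LadderLine.exists_isLUB hI countable_Iic_omega1 fun a b hab => hg a b a.2 b.2 hab
  · intro g hg _
    rw [image_eq_range]
    exact LadderLine.exists_isGLB hI fun a b hab => hg a b a.2 b.2 hab
  · intro Y hY
    obtain ⟨f, hf, hfY⟩ := LadderLine.exists_strictMono countable_Iic_omega1 hb hY
    classical
    let F (a : Ordinal) := if h : a ∈ Iio omega1 then f (e ⟨a, h⟩) else LadderLine.ofList []
    have hF (a : Ordinal) (ha : a ∈ Iio omega1) : F a = f (e ⟨a, ha⟩) := dif_pos ha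
    refine Or.inl ⟨F, fun a ha => ?_, fun a b ha hb' hab => ?_⟩
    · rw [hF a ha]
      exact hfY _
    · rw [hF a ha, hF b hb']
      exact hf (e.strictMono hab)
end

section
/- Let X = {x ∈ ℚ^{ω₁} : the support {α < ω₁ : x(α) ≠ 0} of x is finite}, endowed with the lexicographic order (x < y if and only if x(γ) < y(γ) where γ is the least ordinal with x(γ) ≠ y(γ)). Then the compact line 𝕂(X) is Valdivia. -/
universe u

open Set Filter Topology

/-- The set of elements of `ℚ^{ω₁}` with finite support, with the lexicographic order. -/
abbrev LexFinSupp : Type 1 :=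
  {x : Lex (Ordinal.{0} → ℚ) //
    {a : Ordinal.{0} | ofLex x a ≠ 0}.Finite ∧ ∀ a : Ordinal.{0}, ofLex x a ≠ 0 → a < omega1}

theorem compactSpace_finalSegs (X : Type u) [LinearOrder X] : CompactSpace (FinalSegs X) := by
  have h : IsClosed {F : X → Bool | ∀ x y : X, x ≤ y → F x = true → F y = true} := by
    simp only [ofPred_forall]
    refine isClosed_iInter fun x => isClosed_iInter fun y => isClosed_iInter fun _ => ?_
    have hxy : Continuous fun F : X → Bool => (F x, F y) := by fun_prop
    exact (isClosed_discrete {p : Bool × Bool | p.1 = true → p.2 = true}).preimage hxy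
  exact isCompact_iff_compactSpace.mp h.isCompact

namespace LexFinSupp

/-- The (finite) support. -/
noncomputable def support (x : LexFinSupp) : Finset Ordinal.{0} := x.2.1.toFinset

@[simp]
theorem mem_support {x : LexFinSupp} {i : Ordinal.{0}} : i ∈ support x ↔ ofLex x.1 i ≠ 0 := by
  simp [support]

theorem ext_coord {x y : LexFinSupp} (h : ∀ i, ofLex x.1 i = ofLex y.1 i) : x = y :=
  Subtype.ext (funext h)

/-- The largest element of the support (and `0` if the support is empty). -/
noncomputable def top (x : LexFinSupp) : Ordinal.{0} := (support x).sup id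

theorem le_top {x : LexFinSupp} {i : Ordinal.{0}} (hi : i ∈ support x) : i ≤ top x :=
  Finset.le_sup (f := id) hi

theorem top_mem {x : LexFinSupp} (hx : (support x).Nonempty) : top x ∈ support x := by
  obtain ⟨i, hi, h⟩ := Finset.exists_mem_eq_sup _ hx id
  rw [top, h]
  exact hi

open Classical in
/-- Restriction of an element to a set of coordinates, the others being replaced by `0`. -/
noncomputable def restrict (s : Set Ordinal.{0}) (x : LexFinSupp) : LexFinSupp :=
  ⟨toLex fun i => if i ∈ s then ofLex x.1 i else 0,
    x.2.1.subset fun i hi h => hi ((congrArg (ite (i ∈ s) · 0) h).trans (ite_self 0)),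
    fun i hi => x.2.2 i fun h => hi ((congrArg (ite (i ∈ s) · 0) h).trans (ite_self 0))⟩

theorem restrict_apply_of_mem {s : Set Ordinal.{0}} {i : Ordinal.{0}} (x : LexFinSupp)
    (hi : i ∈ s) : ofLex (restrict s x).1 i = ofLex x.1 i := if_pos hi

theorem restrict_apply_of_notMem {s : Set Ordinal.{0}} {i : Ordinal.{0}} (x : LexFinSupp)
    (hi : i ∉ s) : ofLex (restrict s x).1 i = 0 := if_neg hi

theorem restrict_congr {s : Set Ordinal.{0}} {x y : LexFinSupp}
    (h : ∀ i ∈ s, ofLex x.1 i = ofLex y.1 i) : restrict s x = restrict s y := by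
  refine ext_coord fun i => ?_
  by_cases hi : i ∈ s
  · rw [restrict_apply_of_mem x hi, restrict_apply_of_mem y hi, h i hi]
  · rw [restrict_apply_of_notMem x hi, restrict_apply_of_notMem y hi]

theorem restrict_eq_self {s : Set Ordinal.{0}} {x : LexFinSupp} (h : ↑(support x) ⊆ s) :
    restrict s x = x := by
  refine ext_coord fun i => ?_
  by_cases hi : i ∈ s
  · exact restrict_apply_of_mem x hi
  · rw [restrict_apply_of_notMem x hi]
    by_contra hne
    exact hi (h (Finset.mem_coe.2 (mem_support.2 (Ne.symm hne))))

/-- Restriction to an initial segment of coordinates is monotone. -/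
theorem restrict_Iic_mono (a : Ordinal.{0}) : Monotone (restrict (Iic a)) := by
  intro x y hxy
  rcases hxy.eq_or_lt with rfl | hlt
  · exact le_rfl
  obtain ⟨i, hj, hi⟩ : ∃ i, (∀ j < i, ofLex x.1 j = ofLex y.1 j) ∧ ofLex x.1 i < ofLex y.1 i := hlt
  by_cases hia : i ≤ a
  · refine le_of_lt (show (restrict (Iic a) x).1 < (restrict (Iic a) y).1 from ⟨i, ?_, ?_⟩)
    · intro j hji
      have hja : j ∈ Iic a := hji.le.trans hia
      exact (restrict_apply_of_mem x hja).trans ((hj j hji).trans (restrict_apply_of_mem y hja).symm)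
    · exact (restrict_apply_of_mem x hia).trans_lt
        (hi.trans_eq (restrict_apply_of_mem y hia).symm)
  · exact (restrict_congr fun j hja => hj j (lt_of_le_of_lt hja (not_le.1 hia))).le

/-- The element obtained by deleting the last nonzero coordinate. -/
noncomputable def pred (x : LexFinSupp) : LexFinSupp := restrict {top x}ᶜ x

theorem card_support_pred_lt {x : LexFinSupp} (hx : (support x).Nonempty) :
    (support (pred x)).card < (support x).card := by
  refine Finset.card_lt_card (Finset.ssubset_iff_of_subset ?_ |>.2 ⟨top x, top_mem hx, ?_⟩)
  · intro i hi
    by_cases h : i ∈ ({top x}ᶜ : Set Ordinal.{0})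
    · rw [mem_support, pred, restrict_apply_of_mem x h] at hi
      exact mem_support.2 hi
    · rw [mem_support, pred, restrict_apply_of_notMem x h] at hi
      exact absurd rfl hi
  · exact fun h => mem_support.1 h (restrict_apply_of_notMem x (not_not.2 rfl))

theorem countable_setOf_support_subset {s : Set Ordinal.{0}} (hs : s.Countable) :
    {x : LexFinSupp | ↑(support x) ⊆ s}.Countable := by
  have := hs.to_subtype
  let f (x : LexFinSupp) : s →₀ ℚ :=
    Finsupp.ofSupportFinite (fun i => ofLex x.1 i) (x.2.1.preimage Subtype.val_injective.injOn)
  refine MapsTo.countable_of_injOn (f := f) (mapsTo_univ _ _) ?_ (countable_univ)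
  intro x hx y hy hxy
  rw [← restrict_eq_self hx, ← restrict_eq_self hy]
  exact restrict_congr fun i hi => DFunLike.congr_fun hxy ⟨i, hi⟩

theorem countable_Iic_of_lt_omega1 {a : Ordinal.{0}} (ha : a < omega1) : (Iic a).Countable := by
  rw [← Order.Iio_succ, ← Cardinal.le_aleph0_iff_set_countable, Cardinal.mk_Iio_ordinal,
    Cardinal.lift_le_aleph0, ← Cardinal.lt_aleph_one_iff, ← Cardinal.lt_ord]
  exact (Cardinal.isSuccLimit_ord (Cardinal.aleph0_le_aleph 1)).succ_lt ha

open Classical in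
/-- The coordinate at `x` records whether membership in `F` changes when the last nonzero
coordinate of `x` is deleted. -/
noncomputable def embed (F : FinalSegs LexFinSupp) (x : LexFinSupp) : ℝ :=
  if F.1 x = (if (support x).Nonempty then F.1 (pred x) else false) then 0 else 1

theorem continuous_embed : Continuous embed := by
  refine continuous_pi fun x => ?_
  have h : Continuous fun F : FinalSegs LexFinSupp => (F.1 x, F.1 (pred x)) :=
    ((continuous_apply x).comp continuous_subtype_val).prodMk
      ((continuous_apply (pred x)).comp continuous_subtype_val)
  classical
  exact (continuous_of_discreteTopology (f := fun p : Bool × Bool =>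
    if p.1 = (if (support x).Nonempty then p.2 else false) then (0 : ℝ) else 1)).comp h

theorem embed_injective : Function.Injective embed := by
  intro F G hFG
  refine Subtype.ext (funext fun x => ?_)
  induction hn : (support x).card using Nat.strong_induction_on generalizing x with
  | _ n ih =>
    have hx := congrFun hFG x
    unfold embed at hx
    by_cases hne : (support x).Nonempty
    · have hp := ih _ (hn ▸ card_support_pred_lt hne) (pred x) rfl
      simp only [hne, if_true, hp] at hx
      cases hF : F.1 x <;> cases hG : G.1 x <;> cases hq : G.1 (pred x) <;> simp_all
    · simp only [hne, if_false] at hx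
      cases hF : F.1 x <;> cases hG : G.1 x <;> simp_all

/-- The final segment of all points whose restriction to the coordinates up to `a` lies in `F`. -/
noncomputable def comapRestrict (a : Ordinal.{0}) (F : FinalSegs LexFinSupp) :
    FinalSegs LexFinSupp :=
  ⟨fun x => F.1 (restrict (Iic a) x), fun _ _ hxy => F.2 _ _ (restrict_Iic_mono a hxy)⟩

theorem countable_embed_comapRestrict {a : Ordinal.{0}} (ha : a < omega1)
    (F : FinalSegs LexFinSupp) : {x | embed (comapRestrict a F) x ≠ 0}.Countable := by
  refine (countable_setOf_support_subset (countable_Iic_of_lt_omega1 ha)).mono fun x hx => ?_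
  by_contra hsupp
  obtain ⟨i, hi, hia⟩ := not_subset.1 hsupp
  have hne : (support x).Nonempty := ⟨i, hi⟩
  have hat : a < top x := (not_le.1 hia).trans_le (le_top hi)
  refine hx ?_
  have hr : restrict (Iic a) (pred x) = restrict (Iic a) x :=
    restrict_congr fun j hj => restrict_apply_of_mem x (hj.trans_lt hat).ne
  simp [embed, hne, comapRestrict, hr]

theorem exists_support_subset_Iic (S : Finset LexFinSupp) :
    ∃ a < omega1, ∀ x ∈ S, ↑(support x) ⊆ Iic a := by
  refine ⟨S.sup top, ?_, fun x hx i hi => (le_top hi).trans (Finset.le_sup hx)⟩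
  have hpos : ⊥ < omega1 :=
    bot_lt_iff_ne_bot.2 (Cardinal.isSuccLimit_ord (Cardinal.aleph0_le_aleph 1)).ne_bot
  exact (Finset.sup_lt_iff hpos).2 fun x _ =>
    (Finset.sup_lt_iff hpos).2 fun i hi => x.2.2 i (mem_support.1 hi)

theorem dense_countable_embed : Dense {F | {x | embed F x ≠ 0}.Countable} := by
  refine dense_iff_inter_open.2 ?_
  rintro _ ⟨W, hW, rfl⟩ ⟨F, hF⟩
  obtain ⟨S, u, hu, hSW⟩ := isOpen_pi_iff.1 hW F.1 hF
  obtain ⟨a, ha, hS⟩ := exists_support_subset_Iic S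
  refine ⟨comapRestrict a F, hSW fun x hx => ?_, countable_embed_comapRestrict ha F⟩
  have : (comapRestrict a F).1 x = F.1 x := congrArg F.1 (restrict_eq_self (hS x hx))
  exact this ▸ (hu x hx).2

end LexFinSupp

theorem finalSegs_lexFinSupp_isValdivia : IsValdivia (FinalSegs LexFinSupp) := by
  have := compactSpace_finalSegs LexFinSupp
  exact ⟨LexFinSupp, LexFinSupp.embed,
    (LexFinSupp.continuous_embed.isClosedEmbedding LexFinSupp.embed_injective).isEmbedding,
    LexFinSupp.dense_countable_embed⟩
end

section
/- Let K be a compact line satisfying: (i) K has a basis of open sets of cardinality at most ℵ₁; (ii) every point x ∈ K whose neighborhood filter has no countable basis is isolated from one side, i.e. one of the intervals (←, x] or [x, →) is open in K; (iii) every closed first countable subspace of K is metrizable. If, moreover, the closure in K of the set of points whose neighborhood filter has no countable basis is scattered, then K is Valdivia. -/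
universe u

open Set Filter Topology

/-- A subset `S` of a topological space is scattered if every nonempty subset of `S` has a
point which is relatively isolated in it. -/
def IsScatteredSet {K : Type u} [TopologicalSpace K] (S : Set K) : Prop :=
  ∀ T ⊆ S, T.Nonempty → ∃ x ∈ T, ∃ U : Set K, IsOpen U ∧ U ∩ T = {x}

/-- The set of points below `x` has a countable cofinal subset. -/
def CountableLeftCofinality {K : Type u} [LinearOrder K] (x : K) : Prop :=
  ∃ Y : Set K, Y.Countable ∧ Y ⊆ Iio x ∧ ∀ p < x, ∃ y ∈ Y, p ≤ y

lemma IsLUB.lt_of_not_countableLeftCofinality {K : Type u} [LinearOrder K] {x s : K}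
    (hx : ¬ CountableLeftCofinality x) {Y : Set K} (hYc : Y.Countable) (hYx : Y ⊆ Iio x)
    (hs : IsLUB Y s) : s < x := by
  refine lt_of_le_of_ne (hs.2 fun y hy => (hYx hy).le) ?_
  rintro rfl
  refine hx ⟨Y, hYc, hYx, fun p hp => ?_⟩
  obtain ⟨y, hy, hpy⟩ := (lt_isLUB_iff hs).1 hp
  exact ⟨y, hy, hpy.le⟩

lemma nonempty_Ioo_of_not_countableLeftCofinality {K : Type u} [LinearOrder K] {x : K}
    (hx : ¬ CountableLeftCofinality x) {z : K} (hz : z < x) : (Ioo z x).Nonempty := by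
  by_contra he
  refine hx ⟨{z}, countable_singleton z, by simpa using hz, fun p hp => ⟨z, rfl, ?_⟩⟩
  by_contra hlt
  exact he ⟨p, not_le.1 hlt, hp⟩

/-- Some family of continuous real functions separates the points of `S`, and only countably many
of them are nonzero at any given point of countable character. -/
def SigmaSeparated {K : Type u} [TopologicalSpace K] (S : Set K) : Prop :=
  ∃ A : Set C(K, ℝ), (∀ z : K, (𝓝 z).IsCountablyGenerated → {f ∈ A | f z ≠ 0}.Countable) ∧
    ∀ p ∈ S, ∀ q ∈ S, p ≠ q → ∃ f ∈ A, f p ≠ f q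

section Character

variable {K : Type u} [TopologicalSpace K] [LinearOrder K] [OrderTopology K]

lemma exists_isLUB_of_nonempty [CompactSpace K] {Y : Set K} (hY : Y.Nonempty) :
    ∃ s, IsLUB Y s := by
  obtain ⟨s, -, hs⟩ := isClosed_closure.isCompact.exists_isLUB (hY.mono subset_closure)
  refine ⟨s, fun y hy => hs.1 (subset_closure hy), fun b hb => hs.2 fun y hy => ?_⟩
  exact closure_minimal (fun z hz => hb hz) isClosed_Iic hy

lemma CountableLeftCofinality.isCountablyGenerated_nhds {x : K} (hx : IsOpen (Iic x))
    (h : CountableLeftCofinality x) : (𝓝 x).IsCountablyGenerated := by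
  obtain ⟨Y, hYc, hYx, hY⟩ := h
  by_cases hmin : ∃ l, l < x
  · have hb : (𝓝 x).HasBasis (fun y => y ∈ Y) (fun y => Ioc y x) := by
      refine ⟨fun t => ⟨fun ht => ?_, fun ⟨y, hy, hyt⟩ => ?_⟩⟩
      · obtain ⟨l, hl, hlt⟩ := exists_Ioc_subset_of_mem_nhds ht hmin
        obtain ⟨y, hy, hly⟩ := hY l hl
        exact ⟨y, hy, (Ioc_subset_Ioc_left hly).trans hlt⟩
      · refine mem_of_superset ?_ hyt
        exact inter_mem (Ioi_mem_nhds (hYx hy)) (hx.mem_nhds self_mem_Iic)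
    exact HasCountableBasis.isCountablyGenerated ⟨hb, hYc⟩
  · push Not at hmin
    have : 𝓝 x = pure x := by
      refine le_antisymm (le_pure_iff.2 ?_) (pure_le_nhds x)
      refine mem_of_superset (hx.mem_nhds self_mem_Iic) fun z hz => ?_
      exact le_antisymm hz (hmin z)
    rw [this]
    infer_instance

lemma countableLeftCofinality_of_isCountablyGenerated_nhds {x : K}
    (h : (𝓝 x).IsCountablyGenerated) : CountableLeftCofinality x := by
  by_cases hgap : ∃ y < x, Ioo y x = ∅
  · obtain ⟨y, hy, he⟩ := hgap
    refine ⟨{y}, countable_singleton y, by simpa using hy, fun p hp => ⟨y, rfl, ?_⟩⟩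
    by_contra hlt
    exact (he ▸ (⟨not_le.1 hlt, hp⟩ : p ∈ Ioo y x) : p ∈ (∅ : Set K))
  by_cases hmin : ∃ l, l < x
  · push Not at hgap
    obtain ⟨U, hU⟩ := (𝓝 x).exists_antitone_basis
    have hne : ∀ n, ∃ y ∈ U n, y < x := fun n => by
      obtain ⟨l, hl, hlU⟩ :=
        exists_Ioc_subset_of_mem_nhds (hU.1.mem_of_mem trivial : U n ∈ 𝓝 x) hmin
      obtain ⟨y, hy⟩ := hgap l hl
      exact ⟨y, hlU ⟨hy.1, hy.2.le⟩, hy.2⟩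
    choose y hyU hyx using hne
    refine ⟨range y, countable_range y, range_subset_iff.2 hyx, fun p hp => ?_⟩
    obtain ⟨n, -, hn⟩ := hU.1.mem_iff.1 (Ioi_mem_nhds hp)
    exact ⟨y n, mem_range_self n, (hn (hyU n)).le⟩
  · exact ⟨∅, countable_empty, empty_subset _, fun p hp => (hmin ⟨p, hp⟩).elim⟩

lemma isCountablyGenerated_nhds_of_isLUB
    (hiso : ∀ x : K, ¬ (𝓝 x).IsCountablyGenerated → IsOpen (Iic x) ∨ IsOpen (Ici x))
    {Y : Set K} (hYc : Y.Countable) (hYne : Y.Nonempty) {s : K} (hs : IsLUB Y s)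
    (hsY : s ∉ Y) : (𝓝 s).IsCountablyGenerated := by
  by_contra hG
  rcases hiso s hG with h | h
  · refine hG (CountableLeftCofinality.isCountablyGenerated_nhds h ⟨Y, hYc, ?_, ?_⟩)
    · exact fun y hy => lt_of_le_of_ne (hs.1 hy) fun e => hsY (e ▸ hy)
    · intro p hp
      obtain ⟨y, hy, hpy⟩ := (lt_isLUB_iff hs).1 hp
      exact ⟨y, hy, hpy.le⟩
  · obtain ⟨y, hys, hyY⟩ := mem_closure_iff.1 (hs.mem_closure hYne) _ h self_mem_Ici
    exact hsY (le_antisymm hys (hs.1 hyY) ▸ hyY)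

lemma exists_isCountablyGenerated_nhds_between [CompactSpace K]
    (hiso : ∀ x : K, ¬ (𝓝 x).IsCountablyGenerated → IsOpen (Iic x) ∨ IsOpen (Ici x))
    {x : K} (hx : ¬ CountableLeftCofinality x) {z : K} (hz : z < x) :
    ∃ g, (𝓝 g).IsCountablyGenerated ∧ z < g ∧ g < x := by
  have hnext : ∀ w : Iio x, ∃ v : Iio x, w < v := fun w => by
    obtain ⟨v, hv⟩ := nonempty_Ioo_of_not_countableLeftCofinality hx w.2
    exact ⟨⟨v, hv.2⟩, hv.1⟩
  choose next hnext using hnext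
  let u : ℕ → Iio x := fun n => next^[n] ⟨z, hz⟩
  have hu : ∀ n, u n < u (n + 1) := fun n => by
    simp only [u, Function.iterate_succ_apply']
    exact hnext _
  let v : ℕ → K := fun n => u n
  obtain ⟨s, hs⟩ := exists_isLUB_of_nonempty (range_nonempty v)
  have hlt : ∀ n, v n < s := fun n => lt_of_lt_of_le (hu n) (hs.1 (mem_range_self (n + 1)))
  refine ⟨s, ?_, hlt 0, ?_⟩
  · refine isCountablyGenerated_nhds_of_isLUB hiso (countable_range v) (range_nonempty v) hs ?_
    rintro ⟨n, hn⟩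
    exact (hlt n).ne hn
  · exact hs.lt_of_not_countableLeftCofinality hx (countable_range v)
      (range_subset_iff.2 fun n => (u n).2)

lemma mem_closure_of_isOpen_Iic [CompactSpace K]
    (hiso : ∀ x : K, ¬ (𝓝 x).IsCountablyGenerated → IsOpen (Iic x) ∨ IsOpen (Ici x))
    {x : K} (hx : ¬ (𝓝 x).IsCountablyGenerated) (ho : IsOpen (Iic x)) :
    x ∈ closure {z : K | (𝓝 z).IsCountablyGenerated} := by
  have hc : ¬ CountableLeftCofinality x := fun h => hx (h.isCountablyGenerated_nhds ho)
  have hmin : ∃ l, l < x := by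
    by_contra hmin
    exact hc ⟨∅, countable_empty, empty_subset _, fun p hp => (hmin ⟨p, hp⟩).elim⟩
  refine mem_closure_iff_nhds.2 fun t ht => ?_
  obtain ⟨l, hl, hlt⟩ := exists_Ioc_subset_of_mem_nhds ht hmin
  obtain ⟨g, hg, hlg, hgx⟩ := exists_isCountablyGenerated_nhds_between hiso hc hl
  exact ⟨g, hlt ⟨hlg, hgx.le⟩, hg⟩

lemma dense_isCountablyGenerated_nhds [CompactSpace K]
    (hiso : ∀ x : K, ¬ (𝓝 x).IsCountablyGenerated → IsOpen (Iic x) ∨ IsOpen (Ici x)) :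
    Dense {z : K | (𝓝 z).IsCountablyGenerated} := by
  intro x
  by_cases hx : (𝓝 x).IsCountablyGenerated
  · exact subset_closure hx
  rcases hiso x hx with h | h
  · exact mem_closure_of_isOpen_Iic hiso hx h
  · have : CompactSpace Kᵒᵈ := ‹CompactSpace K›
    exact mem_closure_of_isOpen_Iic (K := Kᵒᵈ) (fun y hy => (hiso y hy).symm) hx h

end Character

section Separation

variable {K : Type u} [TopologicalSpace K]

lemma sigmaSeparated_of_countable {S : Set K} {A : Set C(K, ℝ)} (hA : A.Countable)
    (h : ∀ p ∈ S, ∀ q ∈ S, p ≠ q → ∃ f ∈ A, f p ≠ f q) : SigmaSeparated S :=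
  ⟨A, fun _ _ => hA.mono (sep_subset _ _), h⟩

lemma SigmaSeparated.mono {S T : Set K} (hT : SigmaSeparated T) (h : S ⊆ T) :
    SigmaSeparated S :=
  let ⟨A, hA, hs⟩ := hT
  ⟨A, hA, fun p hp q hq => hs p (h hp) q (h hq)⟩

lemma SigmaSeparated.isValdivia [CompactSpace K] (h : SigmaSeparated (univ : Set K))
    (hd : Dense {z : K | (𝓝 z).IsCountablyGenerated}) : IsValdivia K := by
  obtain ⟨A, hA, hs⟩ := h
  refine ⟨A, fun x f => f.1 x, ?_, hd.mono fun z hz => ?_⟩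
  · refine (Continuous.isClosedEmbedding ?_ ?_).isEmbedding
    · exact continuous_pi fun f => f.1.continuous
    · intro p q hpq
      by_contra hne
      obtain ⟨f, hf, hfpq⟩ := hs p trivial q trivial hne
      exact hfpq (congrFun hpq ⟨f, hf⟩)
  · refine ((hA z hz).preimage_of_injOn Subtype.val_injective.injOn).mono fun f hf => ?_
    exact ⟨f.2, hf⟩

/-- Countably many separating families, together with countably many further functions. -/
lemma sigmaSeparated_of_iUnion {ι : Type*} [Countable ι] {T : ι → Set K}
    (hT : ∀ i, SigmaSeparated (T i)) {S : Set K} {B : Set C(K, ℝ)} (hB : B.Countable)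
    (h : ∀ p ∈ S, ∀ q ∈ S, p ≠ q → (∃ i, p ∈ T i ∧ q ∈ T i) ∨ ∃ f ∈ B, f p ≠ f q) :
    SigmaSeparated S := by
  choose A hA hs using hT
  refine ⟨(⋃ i, A i) ∪ B, fun z hz => ?_, fun p hp q hq hpq => ?_⟩
  · refine ((countable_iUnion fun i => hA i z hz).union hB).mono ?_
    rintro f ⟨hf | hf, hfz⟩
    · obtain ⟨i, hi⟩ := mem_iUnion.1 hf
      exact Or.inl (mem_iUnion.2 ⟨i, hi, hfz⟩)
    · exact Or.inr hf
  · rcases h p hp q hq hpq with ⟨i, hpi, hqi⟩ | ⟨f, hf, hfpq⟩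
    · obtain ⟨f, hf, hfpq⟩ := hs i p hpi q hqi hpq
      exact ⟨f, Or.inl (mem_iUnion.2 ⟨i, hf⟩), hfpq⟩
    · exact ⟨f, Or.inr hf, hfpq⟩

lemma sigmaSeparated_of_iUnion_of_lt [LinearOrder K] {ι : Type*} [Countable ι] {T : ι → Set K}
    (hT : ∀ i, SigmaSeparated (T i)) {S : Set K} {B : Set C(K, ℝ)} (hB : B.Countable)
    (h : ∀ p ∈ S, ∀ q ∈ S, p < q → (∃ i, p ∈ T i ∧ q ∈ T i) ∨ ∃ f ∈ B, f p ≠ f q) :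
    SigmaSeparated S := by
  refine sigmaSeparated_of_iUnion hT hB fun p hp q hq hpq => ?_
  rcases lt_or_gt_of_ne hpq with hlt | hlt
  · exact h p hp q hq hlt
  · rcases h q hq p hp hlt with ⟨i, hi⟩ | ⟨f, hf, hfpq⟩
    · exact Or.inl ⟨i, hi.symm⟩
    · exact Or.inr ⟨f, hf, hfpq.symm⟩

lemma exists_continuousMap_indicator {s : Set K} (hs : IsClopen s) :
    ∃ f : C(K, ℝ), (∀ z ∈ s, f z = 1) ∧ ∀ z ∉ s, f z = 0 := by
  refine ⟨⟨s.indicator 1, continuous_one.indicator ?_⟩, fun z hz => ?_, fun z hz => ?_⟩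
  · simp [hs.frontier_eq]
  · simp [hz]
  · simp [hz]

lemma sigmaSeparated_of_metrizable [NormalSpace K] {L : Set K} (hL : IsClosed L)
    [CompactSpace K] [TopologicalSpace.MetrizableSpace L] : SigmaSeparated L := by
  rcases L.eq_empty_or_nonempty with rfl | hne
  · exact sigmaSeparated_of_countable countable_empty fun p hp => hp.elim
  have : Nonempty L := hne.to_subtype
  have : CompactSpace L := isCompact_iff_compactSpace.1 hL.isCompact
  let := TopologicalSpace.metrizableSpaceMetric L
  let s := TopologicalSpace.denseSeq L
  have hext : ∀ n, ∃ g : C(K, ℝ), ∀ z : L, g z = dist z (s n) := fun n => by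
    obtain ⟨g, hg⟩ := ContinuousMap.exists_restrict_eq hL
      (⟨fun z => dist z (s n), by fun_prop⟩ : C(L, ℝ))
    exact ⟨g, fun z => DFunLike.congr_fun hg z⟩
  choose g hg using hext
  refine sigmaSeparated_of_countable (countable_range g) fun p hp q hq hpq => ?_
  have hpos : 0 < dist (⟨p, hp⟩ : L) ⟨q, hq⟩ := dist_pos.2 fun e => hpq (congrArg Subtype.val e)
  obtain ⟨n, hn⟩ := (TopologicalSpace.denseRange_denseSeq L).exists_dist_lt
    (⟨p, hp⟩ : L) (half_pos hpos)
  refine ⟨g n, mem_range_self n, fun e => ?_⟩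
  have h1 := hg n ⟨p, hp⟩
  have h2 := hg n ⟨q, hq⟩
  have h3 := dist_triangle_right (⟨p, hp⟩ : L) ⟨q, hq⟩ (s n)
  simp only at h1 h2
  linarith

end Separation

section Line

variable {K : Type u} [TopologicalSpace K] [LinearOrder K] [OrderTopology K]

lemma exists_continuousMap_zero_one [CompactSpace K] {y z : K} (hyz : y < z) :
    ∃ f : C(K, ℝ), (∀ p ≤ y, f p = 0) ∧ ∀ q, z ≤ q → f q = 1 := by
  obtain ⟨f, hf0, hf1, -⟩ := exists_continuous_zero_one_of_isClosed
    (isClosed_Iic (a := y)) (isClosed_Ici (a := z))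
    (disjoint_left.2 fun p hp hq => (hyz.trans_le hq).not_ge hp)
  exact ⟨f, fun p hp => hf0 hp, fun q hq => hf1 hq⟩

lemma exists_countable_vanishing_on_Iic [CompactSpace K] {y : K}
    (hy : (𝓝 y).IsCountablyGenerated) :
    ∃ U : Set C(K, ℝ), U.Countable ∧ (∀ u ∈ U, ∀ p ≤ y, u p = 0) ∧
      ∀ q, y < q → ∃ u ∈ U, u q ≠ 0 := by
  obtain ⟨Y, hYc, hYy, hY⟩ :=
    countableLeftCofinality_of_isCountablyGenerated_nhds (K := Kᵒᵈ) (x := OrderDual.toDual y) hy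
  have hex : ∀ z : Y, ∃ f : C(K, ℝ), (∀ p ≤ y, f p = 0) ∧
      ∀ q, OrderDual.ofDual z.1 ≤ q → f q = 1 :=
    fun z => exists_continuousMap_zero_one (hYy z.2)
  choose u hu0 hu1 using hex
  have := hYc.to_subtype
  refine ⟨range u, countable_range u, ?_, fun q hq => ?_⟩
  · rintro _ ⟨z, rfl⟩
    exact hu0 z
  · obtain ⟨z, hz, hzq⟩ := hY (OrderDual.toDual q) hq
    refine ⟨u ⟨z, hz⟩, mem_range_self _, ?_⟩
    rw [hu1 ⟨z, hz⟩ q hzq]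
    exact one_ne_zero

lemma exists_countable_cut [CompactSpace K]
    (hiso : ∀ x : K, ¬ (𝓝 x).IsCountablyGenerated → IsOpen (Iic x) ∨ IsOpen (Ici x)) (y : K) :
    ∃ U : Set C(K, ℝ), U.Countable ∧ ∀ p < y, ∀ q, y < q → ∃ u ∈ U, u p ≠ u q := by
  by_cases hy : (𝓝 y).IsCountablyGenerated
  · obtain ⟨U, hU, hU0, hU1⟩ := exists_countable_vanishing_on_Iic hy
    refine ⟨U, hU, fun p hp q hq => ?_⟩
    obtain ⟨u, hu, huq⟩ := hU1 q hq
    exact ⟨u, hu, by rw [hU0 u hu p hp.le]; exact huq.symm⟩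
  rcases hiso y hy with h | h
  · obtain ⟨f, hf1, hf0⟩ := exists_continuousMap_indicator ⟨isClosed_Iic, h⟩
    refine ⟨{f}, countable_singleton f, fun p hp q hq => ⟨f, rfl, ?_⟩⟩
    rw [hf1 p hp.le, hf0 q hq.not_ge]
    exact one_ne_zero
  · obtain ⟨f, hf1, hf0⟩ := exists_continuousMap_indicator ⟨isClosed_Ici, h⟩
    refine ⟨{f}, countable_singleton f, fun p hp q hq => ⟨f, rfl, ?_⟩⟩
    rw [hf1 q hq.le, hf0 p hp.not_ge]
    exact zero_ne_one

lemma SigmaSeparated.Icc_union [CompactSpace K]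
    (hiso : ∀ x : K, ¬ (𝓝 x).IsCountablyGenerated → IsOpen (Iic x) ∨ IsOpen (Ici x))
    {a y b : K} (h₁ : SigmaSeparated (Icc a y)) (h₂ : SigmaSeparated (Icc y b)) :
    SigmaSeparated (Icc a b) := by
  obtain ⟨U, hU, hUs⟩ := exists_countable_cut hiso y
  refine sigmaSeparated_of_iUnion_of_lt (T := fun i : Bool => cond i (Icc a y) (Icc y b))
    (by rintro (_ | _) <;> assumption) hU fun p hp q hq hpq => ?_
  rcases le_or_gt q y with hqy | hqy
  · exact Or.inl ⟨true, ⟨hp.1, hpq.le.trans hqy⟩, hq.1, hqy⟩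
  rcases le_or_gt y p with hpy | hpy
  · exact Or.inl ⟨false, ⟨hpy, hp.2⟩, hqy.le, hq.2⟩
  · exact Or.inr (hUs p hpy q hqy)

lemma sigmaSeparated_pair [CompactSpace K] {x z : K} (h : x < z) :
    SigmaSeparated ({x, z} : Set K) := by
  obtain ⟨f, hf0, hf1⟩ := exists_continuousMap_zero_one h
  refine sigmaSeparated_of_iUnion_of_lt (T := fun i : Empty => i.elim) (fun i => i.elim)
    (countable_singleton f) fun p hp q hq hpq => Or.inr ⟨f, rfl, ?_⟩
  have h0 := hf0 x le_rfl
  have h1 := hf1 z le_rfl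
  rcases hp with rfl | rfl <;> rcases hq with rfl | rfl <;> simp_all

/-- A separating family for `[c, d]` can be replaced by one supported on `(c, x]` which also
separates the points of `[c, d]` from the points of `(d, x]`. -/
lemma SigmaSeparated.exists_supported_Ioc [CompactSpace K] {c d x : K} (hcd : c ≤ d)
    (hdx : d ≤ x) (hc : (𝓝 c).IsCountablyGenerated) (hd : (𝓝 d).IsCountablyGenerated)
    (hx : IsOpen (Iic x)) (h : SigmaSeparated (Icc c d)) :
    ∃ A : Set C(K, ℝ), (∀ z : K, (𝓝 z).IsCountablyGenerated → {f ∈ A | f z ≠ 0}.Countable) ∧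
      (∀ f ∈ A, ∀ z, f z ≠ 0 → c < z ∧ z ≤ x) ∧
      ∀ p ∈ Icc c d, ∀ q ∈ Icc c x, p < q → ∃ f ∈ A, f p ≠ f q := by
  obtain ⟨A, hA, hs⟩ := h
  obtain ⟨U, hU, hU0, hU1⟩ := exists_countable_vanishing_on_Iic hd
  obtain ⟨χ, hχ1, hχ0⟩ := exists_continuousMap_indicator ⟨isClosed_Iic, hx⟩
  let clamp : C(K, K) := ⟨fun z => max c (min z d), by fun_prop⟩
  have hclamp : ∀ z, (𝓝 z).IsCountablyGenerated → (𝓝 (clamp z)).IsCountablyGenerated := by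
    intro z hz
    change (𝓝 (max c (min z d))).IsCountablyGenerated
    rcases max_choice c (min z d) with e | e <;> rw [e]
    · exact hc
    · rcases min_choice z d with e | e <;> rw [e] <;> assumption
  have hclamp_mem : ∀ z ∈ Icc c d, clamp z = z := fun z hz => by
    change max c (min z d) = z
    rw [min_eq_left hz.2, max_eq_right hz.1]
  let τ : C(K, ℝ) → C(K, ℝ) := fun f => χ * (f.comp clamp - ContinuousMap.const K (f c))
  have hτ : ∀ f z, τ f z = χ z * (f (clamp z) - f c) := fun f z => rfl
  refine ⟨τ '' A ∪ (fun u => χ * u) '' U, fun z hz => ?_, ?_, fun p hp q hq hpq => ?_⟩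
  · refine (((hA _ (hclamp z hz)).union (hA c hc)).image τ |>.union (hU.image (χ * ·))).mono ?_
    rintro _ ⟨⟨f, hf, rfl⟩ | hf, hfz⟩
    · refine Or.inl ⟨f, ?_, rfl⟩
      by_contra hcon
      simp only [mem_union, mem_sep_iff, hf, true_and, not_or, not_not] at hcon
      exact hfz (by rw [hτ, hcon.1, hcon.2, sub_zero, mul_zero])
    · exact Or.inr hf
  · intro f hf z hfz
    have hzx : z ≤ x ∨ χ z = 0 := by
      by_cases hzx : z ≤ x
      · exact Or.inl hzx
      · exact Or.inr (hχ0 z hzx)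
    rcases hf with ⟨f, -, rfl⟩ | ⟨u, hu, rfl⟩
    · rw [hτ] at hfz
      refine ⟨lt_of_not_ge fun hzc => hfz ?_, hzx.resolve_right (left_ne_zero_of_mul hfz)⟩
      have : clamp z = c := max_eq_left ((min_le_left _ _).trans hzc)
      rw [this, sub_self, mul_zero]
    · have hfz' : χ z * u z ≠ 0 := hfz
      refine ⟨lt_of_not_ge fun hzc => right_ne_zero_of_mul hfz' ?_,
        hzx.resolve_right (left_ne_zero_of_mul hfz')⟩
      exact hU0 u hu z (hzc.trans hcd)
  · rcases le_or_gt q d with hqd | hqd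
    · have hq' : q ∈ Icc c d := ⟨hq.1, hqd⟩
      obtain ⟨f, hf, hfpq⟩ := hs p hp q hq' hpq.ne
      refine ⟨τ f, Or.inl ⟨f, hf, rfl⟩, ?_⟩
      rw [hτ, hτ, hclamp_mem p hp, hclamp_mem q hq', hχ1 p (hp.2.trans hdx), hχ1 q hq.2]
      simpa using hfpq
    · obtain ⟨u, hu, huq⟩ := hU1 q hqd
      refine ⟨χ * u, Or.inr ⟨u, hu, rfl⟩, ?_⟩
      simp only [ContinuousMap.mul_apply, hχ1 p (hp.2.trans hdx), hχ1 q hq.2, hU0 u hu p hp.2,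
        one_mul]
      exact huq.symm

lemma exists_cofinal_card_le_aleph_one
    (hw : ∃ B : Set (Set K), TopologicalSpace.IsTopologicalBasis B ∧
      Cardinal.mk B ≤ Cardinal.aleph 1)
    {x : K} (hx : ¬ CountableLeftCofinality x) :
    ∃ S : Set K, Cardinal.mk S ≤ Cardinal.aleph 1 ∧ S ⊆ Iio x ∧ ∀ z < x, ∃ v ∈ S, z < v := by
  obtain ⟨B, hB, hBc⟩ := hw
  let D : Set B := {b | b.1.Nonempty ∧ b.1 ⊆ Iio x}
  have hex : ∀ b : D, ∃ v, v ∈ b.1.1 := fun b => b.2.1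
  choose v hv using hex
  refine ⟨range v, ?_, range_subset_iff.2 fun b => b.2.2 (hv b), fun z hz => ?_⟩
  · exact Cardinal.mk_range_le.trans ((Cardinal.mk_set_le D).trans hBc)
  · obtain ⟨w, hw⟩ := nonempty_Ioo_of_not_countableLeftCofinality hx hz
    obtain ⟨b, hbB, hwb, hb⟩ := hB.exists_subset_of_mem_open hw isOpen_Ioo
    let i : D := ⟨⟨b, hbB⟩, ⟨w, hwb⟩, fun t ht => (hb ht).2⟩
    exact ⟨v i, mem_range_self i, (hb (hv i)).1⟩

/-- A transfinite sequence of intervals `[y i, s i]` whose end points have countable character,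
which covers a left neighbourhood of `x`, and only countably many of which start below a given
point `z < x`. -/
lemma exists_interval_cover [CompactSpace K]
    (hw : ∃ B : Set (Set K), TopologicalSpace.IsTopologicalBasis B ∧
      Cardinal.mk B ≤ Cardinal.aleph 1)
    (hiso : ∀ x : K, ¬ (𝓝 x).IsCountablyGenerated → IsOpen (Iic x) ∨ IsOpen (Ici x))
    {x : K} (hx : ¬ CountableLeftCofinality x) {a : K} (ha : a < x) :
    ∃ (W : Type u) (y s : W → K), (∀ i, (𝓝 (y i)).IsCountablyGenerated) ∧
      (∀ i, (𝓝 (s i)).IsCountablyGenerated) ∧ (∀ i, a ≤ y i) ∧ (∀ i, y i < s i) ∧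
      (∀ i, s i < x) ∧
      (∀ z < x, {i | y i < z}.Countable) ∧
      ∃ b, a ≤ b ∧ b < x ∧ ∀ z, b ≤ z → z < x → ∃ i, y i ≤ z ∧ z ≤ s i := by
  obtain ⟨S, hSc, hSx, hS⟩ := exists_cofinal_card_le_aleph_one hw hx
  obtain ⟨r, hr, hord⟩ := Cardinal.exists_ord_eq S
  have hcount : ∀ i : S, {j | r j i}.Countable := fun i => by
    rw [← Cardinal.le_aleph0_iff_set_countable, ← Cardinal.lt_aleph_one_iff]
    have := Cardinal.card_typein_lt i hord
    rw [Ordinal.card_typein] at this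
    exact this.trans_le hSc
  have hnext : ∀ u v : K, ∃ g, u < x → v < x →
      (𝓝 g).IsCountablyGenerated ∧ u < g ∧ v < g ∧ g < x := fun u v => by
    by_cases huv : max u v < x
    · obtain ⟨g, hg, h1, h2⟩ := exists_isCountablyGenerated_nhds_between hiso hx huv
      exact ⟨g, fun _ _ => ⟨hg, (le_max_left u v).trans_lt h1, (le_max_right u v).trans_lt h1, h2⟩⟩
    · exact ⟨u, fun h1 h2 => (huv (max_lt h1 h2)).elim⟩
  choose next hnext using hnext
  have hsup : ∀ Y : Set K, ∃ s, Y.Nonempty → IsLUB Y s := fun Y => by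
    by_cases hY : Y.Nonempty
    · obtain ⟨s, hs⟩ := exists_isLUB_of_nonempty hY
      exact ⟨s, fun _ => hs⟩
    · exact ⟨x, fun h => (hY h).elim⟩
  choose sup hsup using hsup
  obtain ⟨b, hb, hab, hbx⟩ := exists_isCountablyGenerated_nhds_between hiso hx ha
  have hwf : WellFounded r := hr.wf
  let y : S → K := hwf.fix fun i ih =>
    sup (insert b {v | ∃ (j : S) (h : r j i), v = next (ih j h) j})
  let s : S → K := fun j => next (y j) j
  have hy : ∀ i, IsLUB (insert b (s '' {j | r j i})) (y i) := fun i => by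
    have : y i = sup (insert b (s '' {j | r j i})) := by
      simp only [y]
      rw [hwf.fix_eq]
      congr 2
      ext v
      constructor
      · rintro ⟨j, hj, rfl⟩
        exact ⟨j, hj, rfl⟩
      · rintro ⟨j, hj, rfl⟩
        exact ⟨j, hj, rfl⟩
    rw [this]
    exact hsup _ (insert_nonempty _ _)
  have hYc : ∀ i, (insert b (s '' {j | r j i})).Countable := fun i =>
    ((hcount i).image s).insert b
  have hyx : ∀ i, y i < x := fun i => by
    induction i using hwf.induction with
    | _ i ih =>
      refine (hy i).lt_of_not_countableLeftCofinality hx (hYc i) ?_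
      rintro _ (rfl | ⟨j, hj, rfl⟩)
      · exact hbx
      · exact (hnext _ _ (ih j hj) (hSx j.2)).2.2.2
  have hs := fun i => hnext _ _ (hyx i) (hSx i.2)
  refine ⟨S, y, s, fun i => ?_, fun i => (hs i).1,
    fun i => hab.le.trans ((hy i).1 (mem_insert _ _)), fun i => (hs i).2.1,
    fun i => (hs i).2.2.2, fun z hz => ?_, b, hab.le, hbx, fun z hbz hzx => ?_⟩
  · by_cases hmem : y i ∈ insert b (s '' {j | r j i})
    · rcases hmem with e | ⟨j, -, e⟩
      · rw [e]; exact hb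
      · rw [← e]; exact (hs j).1
    · exact isCountablyGenerated_nhds_of_isLUB hiso (hYc i) (insert_nonempty _ _) (hy i) hmem
  · obtain ⟨v, hv, hzv⟩ := hS z hz
    refine ((hcount ⟨v, hv⟩).insert ⟨v, hv⟩).mono fun i hi => ?_
    rcases trichotomous_of r i ⟨v, hv⟩ with h | h | h
    · exact Or.inr h
    · exact Or.inl h
    · have h1 : s ⟨v, hv⟩ ≤ y i := (hy i).1 (Or.inr ⟨_, h, rfl⟩)
      exact absurd hi (not_lt.2 ((hzv.trans (hs ⟨v, hv⟩).2.2.1).le.trans h1))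
  · obtain ⟨v, hv, hzv⟩ := hS z hzx
    by_cases hne : {i | z < y i}.Nonempty
    · have hmin := hwf.min_mem _ hne
      obtain ⟨t, ht, hzt⟩ := (lt_isLUB_iff (hy _)).1 hmin
      rcases ht with rfl | ⟨j, hj, rfl⟩
      · exact absurd hzt hbz.not_gt
      · exact ⟨j, not_lt.1 fun hlt => hwf.not_lt_min _ hlt hj, hzt.le⟩
    · refine ⟨⟨v, hv⟩, not_lt.1 fun hlt => hne ⟨_, hlt⟩, ?_⟩
      exact (hzv.trans (hs ⟨v, hv⟩).2.2.1).le

lemma sigmaSeparated_Icc_of_forall_lt [CompactSpace K]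
    (hw : ∃ B : Set (Set K), TopologicalSpace.IsTopologicalBasis B ∧
      Cardinal.mk B ≤ Cardinal.aleph 1)
    (hiso : ∀ x : K, ¬ (𝓝 x).IsCountablyGenerated → IsOpen (Iic x) ∨ IsOpen (Ici x))
    {a x : K} (h : ∀ y < x, SigmaSeparated (Icc a y)) : SigmaSeparated (Icc a x) := by
  rcases le_or_gt x a with hxa | hax
  · exact sigmaSeparated_of_countable countable_empty fun p hp q hq hpq =>
      (hpq (subsingleton_Icc_of_ge hxa hp hq)).elim
  by_cases hc : CountableLeftCofinality x
  · obtain ⟨Y, hYc, hYx, hY⟩ := hc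
    have := hYc.to_subtype
    choose u hu0 hu1 using fun y : Y => exists_continuousMap_zero_one (hYx y.2)
    refine sigmaSeparated_of_iUnion_of_lt (T := fun y : Y => Icc a y.1)
      (fun y => h y (hYx y.2)) (countable_range u) fun p hp q hq hpq => ?_
    rcases hq.2.lt_or_eq with hqx | rfl
    · obtain ⟨y, hy, hqy⟩ := hY q hqx
      exact Or.inl ⟨⟨y, hy⟩, ⟨hp.1, hpq.le.trans hqy⟩, hq.1, hqy⟩
    · obtain ⟨y, hy, hpy⟩ := hY p hpq
      refine Or.inr ⟨u ⟨y, hy⟩, mem_range_self _, ?_⟩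
      rw [hu0 ⟨y, hy⟩ p hpy, hu1 ⟨y, hy⟩ q le_rfl]
      exact zero_ne_one
  have hxG : ¬ (𝓝 x).IsCountablyGenerated := fun hG =>
    hc (countableLeftCofinality_of_isCountablyGenerated_nhds hG)
  have hxo : IsOpen (Iic x) := by
    refine (hiso x hxG).resolve_right fun ho => ?_
    obtain ⟨l, hl, hlx⟩ := exists_Ioc_subset_of_mem_nhds (ho.mem_nhds self_mem_Ici) ⟨a, hax⟩
    obtain ⟨z, hz⟩ := nonempty_Ioo_of_not_countableLeftCofinality hc hl
    exact hz.2.not_ge (hlx ⟨hz.1, hz.2.le⟩)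
  obtain ⟨W, y, s, hy, hs, hay, hys, hsx, hcount, b, hab, hbx, hcov⟩ :=
    exists_interval_cover hw hiso hc hax
  refine SigmaSeparated.Icc_union hiso (h b hbx) ?_
  have hloc : ∀ i, SigmaSeparated (Icc (y i) (s i)) := fun i =>
    (h (s i) (hsx i)).mono (Icc_subset_Icc_left (hay i))
  choose A hA hsupp hsep using fun i =>
    (hloc i).exists_supported_Ioc (hys i).le (hsx i).le (hy i) (hs i) hxo
  have hlt : ∀ p ∈ Icc b x, ∀ q ∈ Icc b x, p < q → ∃ f ∈ ⋃ i, A i, f p ≠ f q := by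
    intro p hp q hq hpq
    obtain ⟨i, hyi, hsi⟩ := hcov p hp.1 (hpq.trans_le hq.2)
    obtain ⟨f, hf, hfpq⟩ := hsep i p ⟨hyi, hsi⟩ q ⟨hyi.trans hpq.le, hq.2⟩ hpq
    exact ⟨f, mem_iUnion.2 ⟨i, hf⟩, hfpq⟩
  refine ⟨⋃ i, A i, fun z hz => ?_, fun p hp q hq hpq => ?_⟩
  · rcases lt_or_ge z x with hzx | hxz
    · refine ((hcount z hzx).biUnion fun i _ => hA i z hz).mono ?_
      rintro f ⟨hf, hfz⟩
      obtain ⟨i, hi⟩ := mem_iUnion.1 hf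
      exact mem_biUnion (hsupp i f hi z hfz).1 ⟨hi, hfz⟩
    · refine countable_empty.mono ?_
      rintro f ⟨hf, hfz⟩
      obtain ⟨i, hi⟩ := mem_iUnion.1 hf
      exact hxG (le_antisymm hxz (hsupp i f hi z hfz).2 ▸ hz)
  · rcases lt_or_gt_of_ne hpq with hlt' | hlt'
    · exact hlt p hp q hq hlt'
    · obtain ⟨f, hf, hfpq⟩ := hlt q hq p hp hlt'
      exact ⟨f, hf, hfpq.symm⟩

end Line

section Scattered

variable {K : Type u} [TopologicalSpace K] [LinearOrder K] [OrderTopology K] [CompactSpace K]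

lemma sigmaSeparated_Icc_of_forall_gt
    (hw : ∃ B : Set (Set K), TopologicalSpace.IsTopologicalBasis B ∧
      Cardinal.mk B ≤ Cardinal.aleph 1)
    (hiso : ∀ x : K, ¬ (𝓝 x).IsCountablyGenerated → IsOpen (Iic x) ∨ IsOpen (Ici x))
    {x b : K} (h : ∀ y, x < y → SigmaSeparated (Icc y b)) : SigmaSeparated (Icc x b) := by
  have : CompactSpace Kᵒᵈ := ‹CompactSpace K›
  have hd : SigmaSeparated (K := Kᵒᵈ) (Icc (OrderDual.toDual b) (OrderDual.toDual x)) :=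
    sigmaSeparated_Icc_of_forall_lt (K := Kᵒᵈ) hw (fun y hy => (hiso y hy).symm)
      fun y hy => (h (OrderDual.ofDual y) hy).mono fun z hz => ⟨hz.2, hz.1⟩
  exact SigmaSeparated.mono (K := K) hd fun z hz => ⟨hz.2, hz.1⟩

lemma exists_sigmaSeparated_Icc_of_notMem_closure
    (hmetr : ∀ L : Set K, IsClosed L → FirstCountableTopology L →
      TopologicalSpace.MetrizableSpace L)
    {x z : K} (hx : x ∉ closure {x : K | ¬ (𝓝 x).IsCountablyGenerated}) (hxz : x < z) :
    ∃ y, x < y ∧ SigmaSeparated (Icc x y) := by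
  obtain ⟨L, hLx, hL, hLF⟩ :=
    exists_mem_nhds_isClosed_subset (isClosed_closure.isOpen_compl.mem_nhds hx)
  have : FirstCountableTopology L := ⟨fun w => by
    have hw : (𝓝 (w : K)).IsCountablyGenerated := by
      by_contra hw
      exact hLF w.2 (subset_closure hw)
    rw [nhds_subtype]
    infer_instance⟩
  have := hmetr L hL this
  have hLs := sigmaSeparated_of_metrizable hL
  obtain ⟨t, hxt, ht⟩ := exists_Ico_subset_of_mem_nhds hLx ⟨z, hxz⟩
  by_cases hne : ∃ y, x < y ∧ y < t
  · obtain ⟨y, hxy, hyt⟩ := hne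
    exact ⟨y, hxy, hLs.mono ((Icc_subset_Ico_right hyt).trans ht)⟩
  · refine ⟨t, hxt, (sigmaSeparated_pair hxt).mono fun w hw => ?_⟩
    rcases hw.1.eq_or_lt with rfl | h1
    · exact Or.inl rfl
    · exact Or.inr (le_antisymm hw.2 (not_lt.1 fun h2 => hne ⟨w, h1, h2⟩))

/-- If `[c, b]` is not separated by a suitable family, the first obstruction to extending a family
to the right of `c` occurs at some point of `[c, b)`. -/
lemma exists_obstruction
    (hw : ∃ B : Set (Set K), TopologicalSpace.IsTopologicalBasis B ∧
      Cardinal.mk B ≤ Cardinal.aleph 1)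
    (hiso : ∀ x : K, ¬ (𝓝 x).IsCountablyGenerated → IsOpen (Iic x) ∨ IsOpen (Ici x))
    {c b : K} (h : ¬ SigmaSeparated (Icc c b)) :
    ∃ s, c ≤ s ∧ s < b ∧ ∀ z, s < z → ¬ SigmaSeparated (Icc s z) := by
  have hc : SigmaSeparated (Icc c c) := by
    rw [Icc_self]
    exact sigmaSeparated_of_countable countable_empty fun p hp q hq hpq =>
      (hpq (hp.trans hq.symm)).elim
  obtain ⟨s, hs⟩ := exists_isLUB_of_nonempty (Y := {y | c ≤ y ∧ SigmaSeparated (Icc c y)})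
    ⟨c, le_rfl, hc⟩
  have hcs : SigmaSeparated (Icc c s) := by
    refine sigmaSeparated_Icc_of_forall_lt hw hiso fun y hy => ?_
    obtain ⟨w, hw, hyw⟩ := (lt_isLUB_iff hs).1 hy
    exact hw.2.mono (Icc_subset_Icc_right hyw.le)
  have hle : c ≤ s := hs.1 ⟨le_rfl, hc⟩
  refine ⟨s, hle, lt_of_not_ge fun hbs => h (hcs.mono (Icc_subset_Icc_right hbs)), ?_⟩
  intro z hsz hz
  exact hsz.not_ge (hs.1 ⟨hle.trans hsz.le, hcs.Icc_union hiso hz⟩)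

end Scattered

theorem isValdivia_of_scattered_closure (K : Type u) [TopologicalSpace K] [LinearOrder K]
    [OrderTopology K] [CompactSpace K]
    (hw : ∃ B : Set (Set K), TopologicalSpace.IsTopologicalBasis B ∧
      Cardinal.mk B ≤ Cardinal.aleph 1)
    (hiso : ∀ x : K, ¬ (𝓝 x).IsCountablyGenerated →
      IsOpen (Set.Iic x) ∨ IsOpen (Set.Ici x))
    (hmetr : ∀ L : Set K, IsClosed L → FirstCountableTopology L →
      TopologicalSpace.MetrizableSpace L)
    (hscat : IsScatteredSet (closure {x : K | ¬ (𝓝 x).IsCountablyGenerated})) :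
    IsValdivia K := by
  rcases isEmpty_or_nonempty K with hK | hK
  · exact (sigmaSeparated_of_countable countable_empty fun p => hK.elim p).isValdivia
      (dense_isCountablyGenerated_nhds hiso)
  refine SigmaSeparated.isValdivia ?_ (dense_isCountablyGenerated_nhds hiso)
  by_contra hnot
  obtain ⟨m, -, hm⟩ := isCompact_univ.exists_isLeast (univ_nonempty (α := K))
  obtain ⟨M, -, hM⟩ := isCompact_univ.exists_isGreatest (univ_nonempty (α := K))
  have hmM : ¬ SigmaSeparated (Icc m M) := fun h =>
    hnot (h.mono fun z _ => ⟨hm trivial, hM trivial⟩)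
  let T : Set K := {x | (∃ z, x < z) ∧ ∀ z, x < z → ¬ SigmaSeparated (Icc x z)}
  have hT : T ⊆ closure {x : K | ¬ (𝓝 x).IsCountablyGenerated} := by
    rintro x ⟨⟨z, hxz⟩, hx⟩
    by_contra hxF
    obtain ⟨y, hxy, hy⟩ := exists_sigmaSeparated_Icc_of_notMem_closure hmetr hxF hxz
    exact hx y hxy hy
  have hTne : T.Nonempty := by
    obtain ⟨s, -, hsM, hs⟩ := exists_obstruction hw hiso hmM
    exact ⟨s, ⟨M, hsM⟩, hs⟩
  obtain ⟨x, ⟨hxz, hx⟩, U, hU, hUT⟩ := hscat T hT hTne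
  have hxU : x ∈ U := (hUT ▸ mem_singleton x : x ∈ U ∩ T).1
  obtain ⟨b, hxb, hbU⟩ := exists_Ico_subset_of_mem_nhds (hU.mem_nhds hxU) hxz
  obtain ⟨c, hxc, hc⟩ : ∃ c, x < c ∧ ¬ SigmaSeparated (Icc c b) := by
    by_contra! hcon
    exact hx b hxb (sigmaSeparated_Icc_of_forall_gt hw hiso hcon)
  obtain ⟨s, hcs, hsb, hs⟩ := exists_obstruction hw hiso hc
  have hxs := hxc.trans_le hcs
  have : s ∈ U ∩ T := ⟨hbU ⟨hxs.le, hsb⟩, ⟨b, hsb⟩, hs⟩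
  rw [hUT] at this
  exact hxs.ne' this
end
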